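/- arXiv:2203.07652 — 2 statements merged into one kernel-verified Lean document; each statement's English description precedes it below -/
import Mathlib

section
/- Let (Ω, 𝓕, P) be a probability space and X₁, …, Xₙ (n ≥ 2) real random variables that are jointly centered Gaussian with covariance matrix Σ_{ij} = E[X_i X_j] (positive semidefinite). For bounded complex random variables Y₁, …, Yₙ define the truncated expectation (joint cumulant) 𝓔ᵀ(Y₁; …; Yₙ) = ∑_{π} (−1)^{|π|−1} (|π|−1)! ∏_{B∈π} E[∏_{i∈B} Y_i], the sum running over all set partitions π of {1,…,n}. Then for every choice of signs ε₁, …, εₙ ∈ {−1, +1}, |𝓔ᵀ(e^{iε₁X₁}; …; e^{iεₙXₙ})| ≤ ∑_{T} ∏_{{i,j}∈E(T)} |Σ_{ij}|, where the sum runs over all trees T (connected acyclic simple graphs) on the vertex set {1,…,n} and E(T) is the edge set of T. -/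
/-!
Statement 7: Brydges–Battle–Federbush-type tree bound for the truncated
expectation (joint cumulant) of Gaussian exponentials:
`|𝓔ᵀ(e^{iε₁X₁}; …; e^{iεₙXₙ})| ≤ ∑_{trees T on {1,…,n}} ∏_{{i,j}∈E(T)} |Σ_{ij}|`.
-/

open MeasureTheory Complex

open scoped Classical

noncomputable section

namespace SommerfieldStmt7

/-- `π` is a set partition of `{1,…,n}`: its blocks are nonempty and every
index lies in exactly one block. -/
def IsSetPartition {n : ℕ} (π : Finset (Finset (Fin n))) : Prop :=
  (∀ B ∈ π, B.Nonempty) ∧ ∀ i : Fin n, ∃! B, B ∈ π ∧ i ∈ B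

/-- The truncated expectation (joint cumulant)
`𝓔ᵀ(Y₁;…;Yₙ) = ∑_π (−1)^{|π|−1}(|π|−1)! ∏_{B∈π} E[∏_{i∈B} Y_i]`,
the sum running over all set partitions of `{1,…,n}`. -/
def truncExp {Ω : Type*} [MeasurableSpace Ω] (P : Measure Ω)
    {n : ℕ} (Y : Fin n → Ω → ℂ) : ℂ :=
  ∑ π ∈ Finset.univ.filter (fun π : Finset (Finset (Fin n)) => IsSetPartition π),
    (-1 : ℂ) ^ (π.card - 1) * ((π.card - 1).factorial : ℂ) *
      ∏ B ∈ π, ∫ ω, (∏ i ∈ B, Y i ω) ∂P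

section Cumulant

variable {V : Type*} [DecidableEq V]

/-- The total coupling between two vertex sets. -/
def coupling (A : V → V → ℝ) (J K : Finset V) : ℝ := ∑ i ∈ J, ∑ j ∈ K, A i j

theorem coupling_biUnion (A : V → V → ℝ) {σ τ : Finset (Finset V)}
    (hσ : (σ : Set (Finset V)).PairwiseDisjoint id)
    (hτ : (τ : Set (Finset V)).PairwiseDisjoint id) :
    coupling A (σ.biUnion id) (τ.biUnion id) = ∑ B ∈ σ, ∑ C ∈ τ, coupling A B C := by
  unfold coupling
  rw [Finset.sum_biUnion hσ]
  refine Finset.sum_congr rfl fun B _ => ?_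
  rw [Finset.sum_comm (s := τ)]
  refine Finset.sum_congr rfl fun i _ => ?_
  rw [Finset.sum_biUnion hτ]
  rfl

theorem disjoint_biUnion_sdiff {π S : Finset (Finset V)}
    (hπ : (π : Set (Finset V)).PairwiseDisjoint id) (hS : S ⊆ π) :
    Disjoint (S.biUnion id) ((π \ S).biUnion id) := by
  rw [Finset.disjoint_biUnion_left]
  intro B hB
  rw [Finset.disjoint_biUnion_right]
  intro C hC
  rw [Finset.mem_sdiff] at hC
  exact hπ (hS hB) hC.1 (by rintro rfl; exact hC.2 hB)

theorem biUnion_union_biUnion_sdiff {π S : Finset (Finset V)} (hS : S ⊆ π) :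
    S.biUnion id ∪ (π \ S).biUnion id = π.biUnion id := by
  rw [← Finset.union_biUnion, Finset.union_sdiff_of_subset hS]

variable [Fintype V]

/-- The set partitions of the finite set `I`. -/
def setPartitions (I : Finset V) : Finset (Finset (Finset V)) :=
  Finset.univ.filter fun π =>
    ∅ ∉ π ∧ (π : Set (Finset V)).PairwiseDisjoint id ∧ π.biUnion id = I

theorem mem_setPartitions {I : Finset V} {π : Finset (Finset V)} :
    π ∈ setPartitions I ↔
      ∅ ∉ π ∧ (π : Set (Finset V)).PairwiseDisjoint id ∧ π.biUnion id = I := by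
  simp [setPartitions]

/-- The Möbius weight `(-1)^(k-1) (k-1)!` of a partition with `k` blocks. -/
def mobiusWeight (k : ℕ) : ℝ := (-1) ^ (k - 1) * ((k - 1).factorial : ℝ)

/-- The cumulants of a family of moments `f`. -/
def cumulant (f : Finset V → ℝ) (I : Finset V) : ℝ :=
  ∑ π ∈ setPartitions I, mobiusWeight π.card * ∏ B ∈ π, f B

/-- Splitting a partition into two groups of blocks amounts to splitting the ground set and
partitioning both pieces. -/
theorem sum_powerset_setPartitions (I : Finset V)
    (F : Finset (Finset V) → Finset (Finset V) → ℝ) :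
    ∑ J ∈ I.powerset, ∑ σ ∈ setPartitions J, ∑ τ ∈ setPartitions (I \ J), F σ τ =
      ∑ π ∈ setPartitions I, ∑ S ∈ π.powerset, F S (π \ S) := by
  simp only [← Finset.sum_product', Finset.sum_sigma']
  have key : ∀ {J : Finset V} {σ τ : Finset (Finset V)}, σ ∈ setPartitions J →
      τ ∈ setPartitions (I \ J) → Disjoint σ τ := by
    intro J σ τ hσ hτ
    rw [mem_setPartitions] at hσ hτ
    rw [Finset.disjoint_left]
    intro B hB hB'
    obtain ⟨x, hx⟩ : B.Nonempty := by
      rw [Finset.nonempty_iff_ne_empty]; rintro rfl; exact hσ.1 hB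
    have h1 : x ∈ J := hσ.2.2 ▸ Finset.mem_biUnion.2 ⟨B, hB, hx⟩
    have h2 : x ∈ I \ J := hτ.2.2 ▸ Finset.mem_biUnion.2 ⟨B, hB', hx⟩
    exact (Finset.mem_sdiff.1 h2).2 h1
  refine Finset.sum_bij'
    (fun x _ => ⟨x.2.1 ∪ x.2.2, x.2.1⟩)
    (fun x _ => ⟨x.2.biUnion id, x.2, x.1 \ x.2⟩) ?_ ?_ ?_ ?_ ?_
  · rintro ⟨J, σ, τ⟩ h
    simp only [Finset.mem_sigma, Finset.mem_product, Finset.mem_powerset] at h ⊢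
    obtain ⟨hJ, hσ, hτ⟩ := h
    refine ⟨?_, Finset.subset_union_left⟩
    rw [mem_setPartitions] at *
    refine ⟨by simp [hσ.1, hτ.1], ?_, ?_⟩
    · rw [Finset.coe_union, Set.pairwiseDisjoint_union]
      refine ⟨hσ.2.1, hτ.2.1, fun B hB C hC _ => ?_⟩
      refine Finset.disjoint_of_subset_left (u := J) ?_
        (Finset.disjoint_of_subset_right (u := I \ J) ?_ Finset.disjoint_sdiff)
      · rw [← hσ.2.2]; exact Finset.subset_biUnion_of_mem id hB
      · rw [← hτ.2.2]; exact Finset.subset_biUnion_of_mem id hC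
    · rw [Finset.union_biUnion, hσ.2.2, hτ.2.2, Finset.union_sdiff_of_subset hJ]
  · rintro ⟨π, S⟩ h
    simp only [Finset.mem_sigma, Finset.mem_product, Finset.mem_powerset] at h ⊢
    obtain ⟨hπ, hS⟩ := h
    rw [mem_setPartitions] at hπ
    have hu := biUnion_union_biUnion_sdiff hS
    have hd := disjoint_biUnion_sdiff hπ.2.1 hS
    rw [hπ.2.2] at hu
    refine ⟨hu ▸ Finset.subset_union_left, ?_, ?_⟩
    · exact mem_setPartitions.2 ⟨fun h => hπ.1 (hS h),
        hπ.2.1.subset (Finset.coe_subset.2 hS), rfl⟩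
    · refine mem_setPartitions.2 ⟨fun h => hπ.1 (Finset.sdiff_subset h),
        hπ.2.1.subset (Finset.coe_subset.2 Finset.sdiff_subset), ?_⟩
      rw [← hu, Finset.union_sdiff_cancel_left hd]
  · rintro ⟨J, σ, τ⟩ h
    simp only [Finset.mem_sigma, Finset.mem_product, Finset.mem_powerset] at h ⊢
    rw [Finset.union_sdiff_cancel_left (key h.2.1 h.2.2), (mem_setPartitions.1 h.2.1).2.2]
  · rintro ⟨π, S⟩ h
    simp only [Finset.mem_sigma, Finset.mem_powerset] at h ⊢
    rw [Finset.union_sdiff_of_subset h.2]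
  · rintro ⟨J, σ, τ⟩ h
    simp only [Finset.mem_sigma, Finset.mem_product] at h ⊢
    rw [Finset.union_sdiff_cancel_left (key h.2.1 h.2.2)]

/-- Summing the Möbius weights over all ways of separating two given blocks. -/
theorem sum_mobiusWeight_separating {α : Type*} [DecidableEq α] {π : Finset α} {B C : α}
    (hB : B ∈ π) (hC : C ∈ π) (hBC : B ≠ C) :
    ∑ S ∈ π.powerset, (if B ∈ S ∧ C ∉ S then
      mobiusWeight S.card * mobiusWeight (π \ S).card else 0) = -mobiusWeight π.card := by
  obtain ⟨ρ, hCρ, hBρ, rfl⟩ : ∃ ρ : Finset α, C ∉ ρ ∧ B ∉ ρ ∧ π = insert B (insert C ρ) := by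
    refine ⟨(π.erase B).erase C, by simp, by simp, ?_⟩
    rw [Finset.insert_erase (by simp [hC, hBC.symm]), Finset.insert_erase hB]
  have hB' : B ∉ insert C ρ := by simp [hBC, hBρ]
  rw [Finset.sum_powerset_insert hB', Finset.sum_powerset_insert hCρ,
    Finset.sum_powerset_insert hCρ]
  have hz : ∀ S ∈ ρ.powerset, B ∉ S ∧ C ∉ S := fun S hS =>
    ⟨fun h => hBρ (Finset.mem_powerset.1 hS h), fun h => hCρ (Finset.mem_powerset.1 hS h)⟩
  have h1 : ∀ S ∈ ρ.powerset, (if B ∈ insert B S ∧ C ∉ insert B S then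
      mobiusWeight (insert B S).card *
        mobiusWeight (insert B (insert C ρ) \ insert B S).card else 0) =
      (-1) ^ ρ.card * ((S.card.factorial : ℝ) * ((ρ.card - S.card).factorial : ℝ)) := by
    intro S hS
    obtain ⟨hBS, hCS⟩ := hz S hS
    have hc : (insert B (insert C ρ) \ insert B S).card = ρ.card - S.card + 1 := by
      have : insert B (insert C ρ) \ insert B S = insert C (ρ \ S) := by
        ext x; simp only [Finset.mem_sdiff, Finset.mem_insert]; grind
      rw [this, Finset.card_insert_of_notMem (by simp [hCρ]),
        Finset.card_sdiff_of_subset (Finset.mem_powerset.1 hS)]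
    rw [if_pos (by simp [hCS, hBC.symm]), hc, Finset.card_insert_of_notMem hBS]
    have hle := Finset.card_le_card (Finset.mem_powerset.1 hS)
    unfold mobiusWeight
    simp only [Nat.add_sub_cancel]
    rw [← Nat.add_sub_of_le hle, pow_add]
    simp only [Nat.add_sub_cancel_left]
    ring
  rw [Finset.sum_congr rfl h1, Finset.sum_eq_zero, Finset.sum_eq_zero,
    Finset.sum_eq_zero (f := fun t => if B ∈ insert B (insert C t) ∧ _ then _ else _),
    ← Finset.mul_sum, Finset.sum_powerset_apply_card
      (fun k => (k.factorial : ℝ) * ((ρ.card - k).factorial : ℝ))]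
  · have h2 : ∀ k ∈ Finset.range (ρ.card + 1), ρ.card.choose k •
        ((k.factorial : ℝ) * ((ρ.card - k).factorial : ℝ)) = (ρ.card.factorial : ℝ) := by
      intro k hk
      rw [← Nat.choose_mul_factorial_mul_factorial (Nat.lt_succ_iff.1 (Finset.mem_range.1 hk))]
      push_cast [nsmul_eq_mul]; ring
    rw [Finset.sum_congr rfl h2, Finset.card_insert_of_notMem hB',
      Finset.card_insert_of_notMem hCρ]
    simp only [mobiusWeight, Nat.add_sub_cancel, Nat.factorial_succ, Finset.sum_const,
      Finset.card_range, nsmul_eq_mul]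
    push_cast; ring
  · intro S hS; simp
  · intro S hS; rw [if_neg]; simp [hz S hS, hBC]
  · intro S hS; rw [if_neg]; simp [hz S hS]

/-- Quadratic relation between cumulants: weighting partitions by the coupling inside the blocks. -/
theorem sum_setPartitions_coupling (A : V → V → ℝ) (f : Finset V → ℝ) (I : Finset V) :
    ∑ π ∈ setPartitions I, (mobiusWeight π.card * ∏ B ∈ π, f B) * ∑ B ∈ π, coupling A B B =
      coupling A I I * cumulant f I +
        ∑ J ∈ I.powerset, coupling A J (I \ J) * (cumulant f J * cumulant f (I \ J)) := by
  have hR : ∑ J ∈ I.powerset, coupling A J (I \ J) * (cumulant f J * cumulant f (I \ J)) =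
      ∑ π ∈ setPartitions I, (∏ B ∈ π, f B) * ∑ B ∈ π, ∑ C ∈ π, if B = C then 0 else
        coupling A B C * -mobiusWeight π.card := by
    calc _ = ∑ J ∈ I.powerset, ∑ σ ∈ setPartitions J, ∑ τ ∈ setPartitions (I \ J),
          coupling A (σ.biUnion id) (τ.biUnion id) *
            ((mobiusWeight σ.card * ∏ B ∈ σ, f B) * (mobiusWeight τ.card * ∏ B ∈ τ, f B)) := by
          refine Finset.sum_congr rfl fun J _ => ?_
          unfold cumulant
          rw [Finset.sum_mul_sum, Finset.mul_sum]
          refine Finset.sum_congr rfl fun σ hσ => ?_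
          rw [Finset.mul_sum]
          refine Finset.sum_congr rfl fun τ hτ => ?_
          rw [(mem_setPartitions.1 hσ).2.2, (mem_setPartitions.1 hτ).2.2]
      _ = _ := by
          rw [sum_powerset_setPartitions I (fun σ τ => coupling A (σ.biUnion id) (τ.biUnion id) *
            ((mobiusWeight σ.card * ∏ B ∈ σ, f B) * (mobiusWeight τ.card * ∏ B ∈ τ, f B)))]
          refine Finset.sum_congr rfl fun π hπ => ?_
          have hd := (mem_setPartitions.1 hπ).2.1
          have h1 : ∀ S ∈ π.powerset, coupling A (S.biUnion id) ((π \ S).biUnion id) *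
              ((mobiusWeight S.card * ∏ B ∈ S, f B) *
                (mobiusWeight (π \ S).card * ∏ B ∈ π \ S, f B)) =
              (∏ B ∈ π, f B) * ∑ B ∈ π, ∑ C ∈ π, coupling A B C * (if B ∈ S ∧ C ∉ S then
                mobiusWeight S.card * mobiusWeight (π \ S).card else 0) := by
            intro S hS
            have hS := Finset.mem_powerset.1 hS
            rw [coupling_biUnion A (hd.subset (Finset.coe_subset.2 hS))
              (hd.subset (Finset.coe_subset.2 Finset.sdiff_subset)),
              ← Finset.prod_sdiff hS]
            have : ∑ B ∈ π, ∑ C ∈ π, coupling A B C * (if B ∈ S ∧ C ∉ S then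
                mobiusWeight S.card * mobiusWeight (π \ S).card else 0) =
                (∑ B ∈ S, ∑ C ∈ π \ S, coupling A B C) *
                  (mobiusWeight S.card * mobiusWeight (π \ S).card) := by
              rw [Finset.sum_mul, ← Finset.sum_subset hS]
              · refine Finset.sum_congr rfl fun B hB => ?_
                rw [Finset.sum_mul, ← Finset.sum_subset Finset.sdiff_subset]
                · refine Finset.sum_congr rfl fun C hC => ?_
                  rw [if_pos ⟨hB, (Finset.mem_sdiff.1 hC).2⟩]
                · intro C hC hC'
                  rw [if_neg, mul_zero]
                  rintro ⟨-, h⟩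
                  exact hC' (Finset.mem_sdiff.2 ⟨hC, h⟩)
              · intro B _ hB
                simp [hB]
            rw [this]; ring
          rw [Finset.sum_congr rfl h1, ← Finset.mul_sum]
          congr 1
          rw [Finset.sum_comm]
          refine Finset.sum_congr rfl fun B hB => ?_
          rw [Finset.sum_comm]
          refine Finset.sum_congr rfl fun C hC => ?_
          rw [← Finset.mul_sum]
          split_ifs with h
          · subst h
            simp
          · rw [sum_mobiusWeight_separating hB hC h]
  rw [hR, cumulant, Finset.mul_sum, ← Finset.sum_add_distrib]
  refine Finset.sum_congr rfl fun π hπ => ?_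
  obtain ⟨-, hd, hI⟩ := mem_setPartitions.1 hπ
  have h2 : ∑ B ∈ π, ∑ C ∈ π, (if B = C then 0 else
      coupling A B C * -mobiusWeight π.card) =
      -mobiusWeight π.card * (coupling A I I - ∑ B ∈ π, coupling A B B) := by
    rw [← hI, coupling_biUnion A hd hd, ← Finset.sum_sub_distrib, Finset.mul_sum]
    refine Finset.sum_congr rfl fun B hB => ?_
    rw [← Finset.add_sum_erase π (fun C => coupling A B C) hB,
      ← Finset.add_sum_erase π (fun C => if B = C then 0 else _) hB, if_pos rfl, zero_add,
      add_sub_cancel_left, Finset.mul_sum]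
    refine Finset.sum_congr rfl fun C hC => ?_
    rw [if_neg (Finset.ne_of_mem_erase hC).symm, mul_comm]
  rw [h2]; ring

theorem mem_setPartitions_iff_forall {I : Finset V} {π : Finset (Finset V)} :
    π ∈ setPartitions I ↔ (∀ B ∈ π, B.Nonempty) ∧
      (∀ B ∈ π, ∀ C ∈ π, ∀ x, x ∈ B → x ∈ C → B = C) ∧ ∀ x, x ∈ I ↔ ∃ B ∈ π, x ∈ B := by
  rw [mem_setPartitions]
  refine and_congr ?_ (and_congr ?_ ?_)
  · constructor
    · intro h B hB
      rw [Finset.nonempty_iff_ne_empty]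
      rintro rfl
      exact h hB
    · intro h h0
      simpa using h _ h0
  · constructor
    · intro h B hB C hC x hxB hxC
      by_contra hne
      exact Finset.disjoint_left.1 (h hB hC hne) hxB hxC
    · intro h B hB C hC hne
      exact Finset.disjoint_left.2 fun x hxB hxC => hne (h B hB C hC x hxB hxC)
  · simp [Finset.ext_iff, eq_comm]

theorem cumulant_singleton (f : Finset V → ℝ) (i : V) : cumulant f {i} = f {i} := by
  have : setPartitions {i} = {{({i} : Finset V)}} := by
    ext π
    rw [mem_setPartitions_iff_forall, Finset.mem_singleton]
    constructor
    · rintro ⟨hne, -, hx⟩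
      have hB : ∀ B ∈ π, B = {i} := fun B hB =>
        Finset.eq_singleton_iff_nonempty_unique_mem.2
          ⟨hne B hB, fun x hxB => Finset.mem_singleton.1 ((hx x).2 ⟨B, hB, hxB⟩)⟩
      obtain ⟨B, hBπ, -⟩ := (hx i).1 (Finset.mem_singleton_self i)
      exact Finset.eq_singleton_iff_nonempty_unique_mem.2 ⟨⟨B, hBπ⟩, hB⟩
    · rintro rfl
      simp
  simp [cumulant, this, mobiusWeight]

/-- Partitions in which `i` and `j` share a block correspond to partitions of the ground set
without `j`. -/
theorem sum_setPartitions_same_block {I : Finset V} {i j : V} (hi : i ∈ I) (hj : j ∈ I)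
    (hij : i ≠ j) (w : ℕ → ℝ) :
    ∑ π ∈ setPartitions I, w π.card * ∑ B ∈ π, (if i ∈ B ∧ j ∈ B then 1 else 0) =
      ∑ π ∈ setPartitions (I.erase j), w π.card := by
  have h1 : ∀ π ∈ setPartitions I, w π.card * ∑ B ∈ π, (if i ∈ B ∧ j ∈ B then (1 : ℝ) else 0) =
      if ∃ B ∈ π, i ∈ B ∧ j ∈ B then w π.card else 0 := by
    intro π hπ
    rw [mem_setPartitions_iff_forall] at hπ
    split_ifs with h
    · obtain ⟨B, hB, hiB, hjB⟩ := h
      rw [Finset.sum_eq_single_of_mem B hB, if_pos ⟨hiB, hjB⟩, mul_one]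
      intro C hC hCB
      rw [if_neg]
      rintro ⟨hiC, -⟩
      exact hCB (hπ.2.1 C hC B hB i hiC hiB)
    · push Not at h
      rw [Finset.sum_eq_zero, mul_zero]
      intro B hB
      rw [if_neg]
      rintro ⟨hiB, hjB⟩
      exact h B hB hiB hjB
  rw [Finset.sum_congr rfl h1, ← Finset.sum_filter]
  symm
  have hnj : ∀ {π : Finset (Finset V)}, π ∈ setPartitions (I.erase j) → ∀ B ∈ π, j ∉ B := by
    intro π hπ B hB hjB
    have := ((mem_setPartitions_iff_forall.1 hπ).2.2 j).2 ⟨B, hB, hjB⟩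
    simp at this
  have herase : ∀ {B : Finset V}, j ∉ B →
      (if i ∈ B then insert j B else B).erase j = B := by
    intro B hB
    split_ifs
    · exact Finset.erase_insert hB
    · exact Finset.erase_eq_of_notMem hB
  refine Finset.sum_bij' (fun π _ => π.image fun B => if i ∈ B then insert j B else B)
    (fun π _ => π.image fun B => B.erase j) ?_ ?_ ?_ ?_ ?_
  · intro π hπ
    have hnj := hnj hπ
    rw [mem_setPartitions_iff_forall] at hπ
    obtain ⟨hne, hd, hx⟩ := hπ
    obtain ⟨B₀, hB₀, hiB₀⟩ := (hx i).1 (by simp [hi, hij])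
    rw [Finset.mem_filter, mem_setPartitions_iff_forall]
    refine ⟨⟨?_, ?_, ?_⟩, insert j B₀, Finset.mem_image.2 ⟨B₀, hB₀, by simp [hiB₀]⟩,
      by simp [hiB₀], by simp⟩
    · simp only [Finset.forall_mem_image]
      intro B hB
      split_ifs
      · exact Finset.insert_nonempty _ _
      · exact hne B hB
    · simp only [Finset.forall_mem_image]
      intro B hB C hC x hxB hxC
      have : B = C := by
        have := hnj B hB; have := hnj C hC; have := hd B hB C hC
        grind
      rw [this]
    · intro x
      simp only [Finset.exists_mem_image]
      have := hx x
      by_cases hxj : x = j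
      · subst hxj
        exact ⟨fun _ => ⟨B₀, hB₀, by simp [hiB₀]⟩, fun _ => hj⟩
      · rw [Finset.mem_erase] at this
        grind
  · intro π hπ
    rw [Finset.mem_filter, mem_setPartitions_iff_forall] at hπ
    obtain ⟨⟨hne, hd, hx⟩, B₀, hB₀, hiB₀, hjB₀⟩ := hπ
    rw [mem_setPartitions_iff_forall]
    refine ⟨?_, ?_, ?_⟩
    · simp only [Finset.forall_mem_image]
      intro B hB
      by_cases hjB : j ∈ B
      · obtain rfl := hd B hB B₀ hB₀ j hjB hjB₀
        exact ⟨i, by simp [hij, hiB₀]⟩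
      · rw [Finset.erase_eq_of_notMem hjB]
        exact hne B hB
    · simp only [Finset.forall_mem_image]
      intro B hB C hC x hxB hxC
      rw [hd B hB C hC x (Finset.mem_of_mem_erase hxB) (Finset.mem_of_mem_erase hxC)]
    · intro x
      simp only [Finset.exists_mem_image, Finset.mem_erase, hx x]
      grind
  · intro π hπ
    rw [Finset.image_image]
    conv_rhs => rw [← Finset.image_id (s := π)]
    exact Finset.image_congr fun B hB => herase (hnj hπ B hB)
  · intro π hπ
    rw [Finset.mem_filter, mem_setPartitions_iff_forall] at hπ
    obtain ⟨⟨hne, hd, hx⟩, B₀, hB₀, hiB₀, hjB₀⟩ := hπ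
    rw [Finset.image_image]
    conv_rhs => rw [← Finset.image_id (s := π)]
    refine Finset.image_congr fun B hB => ?_
    simp only [Function.comp_apply, id, Finset.mem_erase]
    by_cases hiB : i ∈ B
    · obtain rfl := hd B hB B₀ hB₀ i hiB hiB₀
      rw [if_pos ⟨hij, hiB⟩, Finset.insert_erase hjB₀]
    · have hjB : j ∉ B := fun h => hiB (hd B hB B₀ hB₀ j h hjB₀ ▸ hiB₀)
      rw [if_neg (fun h => hiB h.2), Finset.erase_eq_of_notMem hjB]
  · intro π hπ
    rw [Finset.card_image_of_injOn]
    intro B hB C hC h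
    rw [← herase (hnj hπ B hB), ← herase (hnj hπ C hC)]
    exact congrArg (fun D => D.erase j) h

/-- The cumulants of trivial moments vanish beyond the first order. -/
theorem cumulant_one_eq_zero {I : Finset V} (hI : 2 ≤ I.card) :
    cumulant (fun _ => 1) I = 0 := by
  induction hm : I.card using Nat.strong_induction_on generalizing I with
  | _ m ih =>
  subst hm
  obtain ⟨i, hi, j, hj, hij⟩ := Finset.one_lt_card.1 hI
  have hA : ∀ J K : Finset V, coupling (fun a b => if a = i ∧ b = j then 1 else 0) J K =
      if i ∈ J ∧ j ∈ K then 1 else 0 := by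
    intro J K
    simp [coupling, ite_and]
  have key := sum_setPartitions_coupling (fun a b => if a = i ∧ b = j then 1 else 0)
    (fun _ => 1) I
  simp only [hA, Finset.prod_const_one, mul_one] at key
  rw [sum_setPartitions_same_block hi hj hij mobiusWeight, if_pos ⟨hi, hj⟩, one_mul] at key
  have hk : ∑ π ∈ setPartitions (I.erase j), mobiusWeight π.card =
      cumulant (fun _ => 1) (I.erase j) := by simp [cumulant]
  have hcard := Finset.card_erase_of_mem hj
  rw [hk] at key
  rcases hI.eq_or_lt with h2 | h3
  · have hIij : I = {i, j} :=
      (Finset.eq_of_subset_of_card_le (by simp [Finset.insert_subset_iff, hi, hj])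
        (by rw [Finset.card_pair hij, h2])).symm
    have he : I.erase j = {i} := by rw [hIij]; ext x; simp; grind
    rw [Finset.sum_eq_single {i}] at key
    · have hs : I \ {i} = {j} := by rw [hIij]; ext x; simp; grind
      rw [he, hs] at key
      simp only [cumulant_singleton] at key
      simpa using key
    · intro J hJ hne
      rw [if_neg, zero_mul]
      rintro ⟨hiJ, hjJ⟩
      apply hne
      rw [Finset.mem_powerset, hIij] at hJ
      ext x
      have := @hJ x
      simp at this hjJ ⊢
      grind
    · intro h
      simp [hi] at h
  · rw [ih _ (by omega) (I := I.erase j) (by omega) rfl, Finset.sum_eq_zero, add_zero] at key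
    · exact key.symm
    intro J hJ
    split_ifs with h
    · rw [Finset.mem_powerset] at hJ
      have hc := Finset.card_sdiff_add_card_eq_card hJ
      have h1 : 0 < J.card := Finset.card_pos.2 ⟨i, h.1⟩
      have h2 : 0 < (I \ J).card := Finset.card_pos.2 ⟨j, h.2⟩
      rcases Nat.lt_or_ge J.card 2 with hJ2 | hJ2
      · rw [ih _ (by omega) (I := I \ J) (by omega) rfl]; simp
      · rw [ih _ (by omega) (I := J) (by omega) rfl]; simp
    · simp

/-- Differential equation for the cumulants of `exp (-t A(B,B) / 2)`. -/
theorem hasDerivAt_cumulant_exp (A : V → V → ℝ) (I : Finset V) (t : ℝ) :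
    HasDerivAt (fun s => cumulant (fun B => Real.exp (-(s * coupling A B B) / 2)) I)
      (-(coupling A I I * cumulant (fun B => Real.exp (-(t * coupling A B B) / 2)) I +
        ∑ J ∈ I.powerset, coupling A J (I \ J) *
          (cumulant (fun B => Real.exp (-(t * coupling A B B) / 2)) J *
            cumulant (fun B => Real.exp (-(t * coupling A B B) / 2)) (I \ J))) / 2) t := by
  rw [← sum_setPartitions_coupling]
  have hprod : ∀ (π : Finset (Finset V)) (s : ℝ),
      ∏ B ∈ π, Real.exp (-(s * coupling A B B) / 2) =
        Real.exp (s * (-(∑ B ∈ π, coupling A B B) / 2)) := by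
    intro π s
    rw [← Real.exp_sum]
    congr 1
    rw [← Finset.sum_neg_distrib, Finset.sum_div, Finset.mul_sum]
    exact Finset.sum_congr rfl fun B _ => by ring
  simp only [cumulant, hprod]
  rw [← Finset.sum_neg_distrib, Finset.sum_div]
  refine HasDerivAt.fun_sum fun π _ => ?_
  have := (((hasDerivAt_id t).mul_const (-(∑ B ∈ π, coupling A B B) / 2)).exp).const_mul
    (mobiusWeight π.card)
  refine this.congr_deriv ?_
  simp only [id]
  ring

/-- Cumulant bound for stable couplings, in terms of any weight dominating the quadratic
recursion. -/
theorem abs_cumulant_exp_le {A : V → V → ℝ} (hA : ∀ I, 0 ≤ coupling A I I)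
    {W : Finset V → ℝ} (hW : ∀ I, 0 ≤ W I) (hW₁ : ∀ i, 1 ≤ W {i})
    (hrec : ∀ I : Finset V, I.Nonempty →
      ∑ J ∈ I.powerset, |coupling A J (I \ J)| * (W J * W (I \ J)) ≤ 2 * (I.card - 1) * W I)
    {I : Finset V} (hI : I.Nonempty) {t : ℝ} (ht : 0 ≤ t) :
    |cumulant (fun B => Real.exp (-(t * coupling A B B) / 2)) I| ≤ t ^ (I.card - 1) * W I := by
  induction hm : I.card using Nat.strong_induction_on generalizing I t with
  | _ m ih =>
  subst hm
  rcases Nat.lt_or_ge I.card 2 with h1 | h2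
  · obtain ⟨i, rfl⟩ := Finset.card_eq_one.1
      (show I.card = 1 by have := Finset.card_pos.2 hI; omega)
    rw [cumulant_singleton, abs_of_pos (Real.exp_pos _)]
    simp only [Finset.card_singleton, Nat.sub_self, pow_zero, one_mul]
    refine le_trans (Real.exp_le_one_iff.2 ?_) (hW₁ i)
    have := mul_nonneg ht (hA {i})
    linarith
  set κ : Finset V → ℝ → ℝ :=
    fun J s => cumulant (fun B => Real.exp (-(s * coupling A B B) / 2)) J with hκ
  set a := coupling A I I / 2 with ha
  obtain ⟨k, hk⟩ : ∃ k, I.card = k + 2 := ⟨I.card - 2, by omega⟩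
  have hR : ∀ s, 0 ≤ s →
      |∑ J ∈ I.powerset, coupling A J (I \ J) * (κ J s * κ (I \ J) s)| ≤
        2 * ((k + 1) * s ^ k * W I) := by
    intro s hs
    calc _ ≤ ∑ J ∈ I.powerset, |coupling A J (I \ J) * (κ J s * κ (I \ J) s)| :=
          Finset.abs_sum_le_sum_abs _ _
      _ ≤ ∑ J ∈ I.powerset, s ^ k * (|coupling A J (I \ J)| * (W J * W (I \ J))) := by
          refine Finset.sum_le_sum fun J hJ => ?_
          rw [Finset.mem_powerset] at hJ
          rcases J.eq_empty_or_nonempty with rfl | hJn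
          · simp [coupling]
          rcases (I \ J).eq_empty_or_nonempty with h | hKn
          · simp [coupling, h]
          have hc := Finset.card_sdiff_add_card_eq_card hJ
          have h1 := Finset.card_pos.2 hJn
          have h2 := Finset.card_pos.2 hKn
          have b1 := ih J.card (by omega) hJn hs rfl
          have b2 := ih (I \ J).card (by omega) hKn hs rfl
          have hexp : k = (J.card - 1) + ((I \ J).card - 1) := by omega
          rw [abs_mul, abs_mul]
          calc _ ≤ |coupling A J (I \ J)| *
                ((s ^ (J.card - 1) * W J) * (s ^ ((I \ J).card - 1) * W (I \ J))) := by
                gcongr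
                exact mul_nonneg (pow_nonneg hs _) (hW _)
            _ = _ := by rw [hexp, pow_add]; ring
      _ ≤ s ^ k * (2 * (I.card - 1) * W I) := by
          rw [← Finset.mul_sum]
          exact mul_le_mul_of_nonneg_left (hrec I hI) (pow_nonneg hs _)
      _ = _ := by rw [hk]; push_cast; ring
  have hderiv : ∀ s, HasDerivAt (fun s => Real.exp (a * s) * κ I s)
      (Real.exp (a * s) *
        (-(∑ J ∈ I.powerset, coupling A J (I \ J) * (κ J s * κ (I \ J) s)) / 2)) s := by
    intro s
    have h1 := (((hasDerivAt_id s).const_mul a).exp).mul (hasDerivAt_cumulant_exp A I s)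
    refine h1.congr_deriv ?_
    simp only [id, hκ, ha]
    ring
  have hbound : ∀ s, HasDerivAt (fun s => Real.exp (a * s) * (s ^ (k + 1) * W I))
      (Real.exp (a * s) * (a * (s ^ (k + 1) * W I) + (k + 1) * s ^ k * W I)) s := by
    intro s
    have h1 := (((hasDerivAt_id s).const_mul a).exp).mul ((hasDerivAt_pow (k + 1) s).mul_const (W I))
    refine h1.congr_deriv ?_
    simp only [id]
    push_cast
    ring
  have ha0 : 0 ≤ a := div_nonneg (hA I) zero_le_two
  have main := image_norm_le_of_norm_deriv_right_le_deriv_boundary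
    (f := fun s => Real.exp (a * s) * κ I s) (a := 0) (b := t)
    (B := fun s => Real.exp (a * s) * (s ^ (k + 1) * W I))
    (fun s _ => (hderiv s).continuousAt.continuousWithinAt)
    (fun s _ => (hderiv s).hasDerivWithinAt)
    (by simp [hκ, cumulant_one_eq_zero h2]) hbound
    (by
      intro s hs
      rw [Real.norm_eq_abs, abs_mul, abs_of_pos (Real.exp_pos _), abs_div, abs_neg]
      refine mul_le_mul_of_nonneg_left ?_ (Real.exp_pos _).le
      have h1 := hR s hs.1
      have h2 : 0 ≤ a * (s ^ (k + 1) * W I) :=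
        mul_nonneg ha0 (mul_nonneg (pow_nonneg hs.1 _) (hW I))
      rw [abs_of_pos (zero_lt_two' ℝ)]
      linarith)
    (Set.right_mem_Icc.2 ht)
  rw [Real.norm_eq_abs, abs_mul, abs_of_pos (Real.exp_pos _)] at main
  have hk1 : I.card - 1 = k + 1 := by omega
  rw [hk1]
  exact le_of_mul_le_mul_left main (Real.exp_pos _)

end Cumulant

theorem sum_le_sum_of_injOn {α β : Type*} {s : Finset α} {t : Finset β} {f : α → ℝ} {g : β → ℝ}
    (e : α → β) (hmaps : ∀ x ∈ s, e x ∈ t) (hinj : Set.InjOn e s)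
    (hfg : ∀ x ∈ s, f x = g (e x)) (hg : ∀ y ∈ t, 0 ≤ g y) :
    ∑ x ∈ s, f x ≤ ∑ y ∈ t, g y := by
  rw [Finset.sum_congr rfl hfg, ← Finset.sum_image (g := e) hinj]
  exact Finset.sum_le_sum_of_subset_of_nonneg (Finset.image_subset_iff.2 hmaps)
    fun y hy _ => hg y hy

section Tree

variable {V : Type*} [DecidableEq V]

/-- `IsTreeOn I E` says that `E` is the edge set of a tree with vertex set `I`: every tree is a
single vertex or arises from two disjoint trees by adding one edge between them. -/
inductive IsTreeOn : Finset V → Finset (Sym2 V) → Prop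
  | single (v : V) : IsTreeOn {v} ∅
  | join {J K : Finset V} {E F : Finset (Sym2 V)} {i j : V} (hE : IsTreeOn J E)
      (hF : IsTreeOn K F) (hJK : Disjoint J K) (hi : i ∈ J) (hj : j ∈ K) :
      IsTreeOn (J ∪ K) (insert s(i, j) (E ∪ F))

namespace IsTreeOn

theorem nonempty {I : Finset V} {E : Finset (Sym2 V)} (h : IsTreeOn I E) : I.Nonempty := by
  induction h with
  | single v => exact Finset.singleton_nonempty v
  | join _ _ _ _ _ ihE _ => exact ihE.inl

theorem mem_of_mem {I : Finset V} {E : Finset (Sym2 V)} (h : IsTreeOn I E) {e : Sym2 V}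
    (he : e ∈ E) {x : V} (hx : x ∈ e) : x ∈ I := by
  induction h with
  | single v => simp at he
  | join hE hF hJK hi hj ihE ihF =>
    rw [Finset.mem_union]
    rcases Finset.mem_insert.1 he with rfl | he
    · rcases Sym2.mem_iff.1 hx with rfl | rfl
      exacts [Or.inl hi, Or.inr hj]
    · rcases Finset.mem_union.1 he with he | he
      exacts [Or.inl (ihE he), Or.inr (ihF he)]

theorem disjoint_edges {J K : Finset V} {E F : Finset (Sym2 V)} (hE : IsTreeOn J E)
    (hF : IsTreeOn K F) (hJK : Disjoint J K) : Disjoint E F := by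
  rw [Finset.disjoint_left]
  intro e heE heF
  induction e with
  | _ x y =>
  exact Finset.disjoint_left.1 hJK (hE.mem_of_mem heE (Sym2.mem_mk_left x y))
    (hF.mem_of_mem heF (Sym2.mem_mk_left x y))

theorem edge_notMem_union {J K : Finset V} {E F : Finset (Sym2 V)} (hE : IsTreeOn J E)
    (hF : IsTreeOn K F) (hJK : Disjoint J K) {i j : V} (hi : i ∈ J) (hj : j ∈ K) :
    s(i, j) ∉ E ∪ F := by
  rw [Finset.mem_union]
  rintro (h | h)
  · exact Finset.disjoint_left.1 hJK (hE.mem_of_mem h (Sym2.mem_mk_right i j)) hj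
  · exact Finset.disjoint_left.1 hJK hi (hF.mem_of_mem h (Sym2.mem_mk_left i j))

theorem card_edges {I : Finset V} {E : Finset (Sym2 V)} (h : IsTreeOn I E) :
    E.card + 1 = I.card := by
  induction h with
  | single v => simp
  | join hE hF hJK hi hj ihE ihF =>
    rw [Finset.card_insert_of_notMem (hE.edge_notMem_union hF hJK hi hj),
      Finset.card_union_of_disjoint (hE.disjoint_edges hF hJK),
      Finset.card_union_of_disjoint hJK]
    omega

theorem not_isDiag {I : Finset V} {E : Finset (Sym2 V)} (h : IsTreeOn I E) {e : Sym2 V}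
    (he : e ∈ E) : ¬ e.IsDiag := by
  induction h with
  | single v => simp at he
  | join hE hF hJK hi hj ihE ihF =>
    rcases Finset.mem_insert.1 he with rfl | he
    · rw [Sym2.mk_isDiag_iff]
      rintro rfl
      exact Finset.disjoint_left.1 hJK hi hj
    · rcases Finset.mem_union.1 he with he | he
      exacts [ihE he, ihF he]

/-- A relation that holds along the edges of a tree holds between any two of its vertices. -/
theorem rel_of_edges {I : Finset V} {E : Finset (Sym2 V)} (h : IsTreeOn I E)
    {r : V → V → Prop} (hr : Equivalence r) (hedge : ∀ x y, s(x, y) ∈ E → r x y) {x y : V}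
    (hx : x ∈ I) (hy : y ∈ I) : r x y := by
  induction h generalizing x y with
  | single v =>
    rw [Finset.mem_singleton.1 hx, Finset.mem_singleton.1 hy]
    exact hr.refl v
  | @join J K E F i j hE hF hJK hi hj ihE ihF =>
    have hJ : ∀ {x y}, x ∈ J → y ∈ J → r x y := ihE fun x y h => hedge x y (by simp [h])
    have hK : ∀ {x y}, x ∈ K → y ∈ K → r x y := ihF fun x y h => hedge x y (by simp [h])
    have hij : r i j := hedge i j (by simp)
    rcases Finset.mem_union.1 hx with hx | hx <;> rcases Finset.mem_union.1 hy with hy | hy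
    · exact hJ hx hy
    · exact hr.trans (hJ hx hi) (hr.trans hij (hK hj hy))
    · exact hr.trans (hK hx hj) (hr.trans (hr.symm hij) (hJ hi hy))
    · exact hK hx hy

theorem vertices_subset {J J' K' : Finset V} {E E' F' : Finset (Sym2 V)} (hE : IsTreeOn J E)
    (hE' : IsTreeOn J' E') (hF' : IsTreeOn K' F') (hJK' : Disjoint J' K')
    (hsub : E ⊆ E' ∪ F') {i : V} (hi : i ∈ J) (hi' : i ∈ J') : J ⊆ J' := by
  intro x hx
  refine (hE.rel_of_edges (r := fun x y => x ∈ J' ↔ y ∈ J')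
    ⟨fun _ => Iff.rfl, Iff.symm, Iff.trans⟩ ?_ hi hx).1 hi'
  intro x y h
  rcases Finset.mem_union.1 (hsub h) with h | h
  · exact iff_of_true (hE'.mem_of_mem h (Sym2.mem_mk_left x y))
      (hE'.mem_of_mem h (Sym2.mem_mk_right x y))
  · exact iff_of_false
      (Finset.disjoint_right.1 hJK' (hF'.mem_of_mem h (Sym2.mem_mk_left x y)))
      (Finset.disjoint_right.1 hJK' (hF'.mem_of_mem h (Sym2.mem_mk_right x y)))

theorem edges_subset {J K' : Finset V} {E E' F' : Finset (Sym2 V)} (hE : IsTreeOn J E)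
    (hF' : IsTreeOn K' F') (hJK' : Disjoint J K') (hsub : E ⊆ E' ∪ F') : E ⊆ E' := by
  intro e he
  rcases Finset.mem_union.1 (hsub he) with h | h
  · exact h
  · induction e with
    | _ x y =>
    exact absurd (hF'.mem_of_mem h (Sym2.mem_mk_left x y))
      (Finset.disjoint_left.1 hJK' (hE.mem_of_mem he (Sym2.mem_mk_left x y)))

/-- Cutting a tree at a given edge determines the two pieces. -/
theorem join_injective {J K J' K' : Finset V} {E F E' F' : Finset (Sym2 V)} {i j : V}
    (hE : IsTreeOn J E) (hF : IsTreeOn K F) (hJK : Disjoint J K) (hi : i ∈ J) (hj : j ∈ K)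
    (hE' : IsTreeOn J' E') (hF' : IsTreeOn K' F') (hJK' : Disjoint J' K') (hi' : i ∈ J')
    (hj' : j ∈ K') (h : insert s(i, j) (E ∪ F) = insert s(i, j) (E' ∪ F')) :
    J = J' ∧ E = E' ∧ F = F' := by
  have hu : E ∪ F = E' ∪ F' := by
    rw [← Finset.erase_insert (hE.edge_notMem_union hF hJK hi hj), h,
      Finset.erase_insert (hE'.edge_notMem_union hF' hJK' hi' hj')]
  have hEs : E ⊆ E' ∪ F' := hu ▸ Finset.subset_union_left
  have hEs' : E' ⊆ E ∪ F := hu ▸ Finset.subset_union_left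
  have hFs : F ⊆ F' ∪ E' := by rw [Finset.union_comm, ← hu]; exact Finset.subset_union_right
  have hFs' : F' ⊆ F ∪ E := by rw [Finset.union_comm, hu]; exact Finset.subset_union_right
  have hJ : J = J' := (hE.vertices_subset hE' hF' hJK' hEs hi hi').antisymm
    (hE'.vertices_subset hE hF hJK hEs' hi' hi)
  have hK : K = K' := (hF.vertices_subset hF' hE' hJK'.symm hFs hj hj').antisymm
    (hF'.vertices_subset hF hE hJK.symm hFs' hj' hj)
  subst hJ hK
  exact ⟨rfl, (hE.edges_subset hF' hJK hEs).antisymm (hE'.edges_subset hF hJK hEs'),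
    (hF.edges_subset hE' hJK.symm hFs).antisymm (hF'.edges_subset hE hJK.symm hFs')⟩

theorem edgeSet_fromEdgeSet {I : Finset V} {E : Finset (Sym2 V)} (h : IsTreeOn I E) :
    (SimpleGraph.fromEdgeSet (E : Set (Sym2 V))).edgeSet = E := by
  rw [SimpleGraph.edgeSet_fromEdgeSet, sdiff_eq_left, Set.disjoint_left]
  exact fun e he => h.not_isDiag he

theorem isTree_fromEdgeSet [Fintype V] {E : Finset (Sym2 V)} (h : IsTreeOn Finset.univ E) :
    (SimpleGraph.fromEdgeSet (E : Set (Sym2 V))).IsTree := by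
  rw [SimpleGraph.isTree_iff_connected_and_card]
  constructor
  · have := h.nonempty.to_type
    refine ⟨fun x y => ?_⟩
    refine h.rel_of_edges (SimpleGraph.reachable_is_equivalence _) ?_
      (Finset.mem_univ x) (Finset.mem_univ y)
    intro x y hxy
    refine SimpleGraph.Adj.reachable ((SimpleGraph.fromEdgeSet_adj _).2 ⟨hxy, ?_⟩)
    exact fun hne => h.not_isDiag hxy (Sym2.mk_isDiag_iff.2 hne)
  · rw [h.edgeSet_fromEdgeSet, Nat.card_coe_set_eq, Set.ncard_coe_finset, h.card_edges,
      Finset.card_univ, Nat.card_eq_fintype_card]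

end IsTreeOn

variable [Fintype V]

/-- The sum over all trees with vertex set `I` of the product of the edge weights `a`. -/
def treeSum (a : Sym2 V → ℝ) (I : Finset V) : ℝ :=
  ∑ E ∈ Finset.univ.filter (fun E : Finset (Sym2 V) => IsTreeOn I E), ∏ e ∈ E, a e

theorem treeSum_nonneg {a : Sym2 V → ℝ} (ha : ∀ e, 0 ≤ a e) (I : Finset V) :
    0 ≤ treeSum a I :=
  Finset.sum_nonneg fun _ _ => Finset.prod_nonneg fun e _ => ha e

theorem one_le_treeSum_singleton {a : Sym2 V → ℝ} (ha : ∀ e, 0 ≤ a e) (v : V) :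
    1 ≤ treeSum a {v} := by
  have := Finset.single_le_sum (f := fun E : Finset (Sym2 V) => ∏ e ∈ E, a e)
    (fun _ _ => Finset.prod_nonneg fun e _ => ha e)
    (Finset.mem_filter.2 ⟨Finset.mem_univ ∅, IsTreeOn.single v⟩)
  simpa [treeSum] using this

theorem card_darts_le (E : Finset (Sym2 V)) :
    (Finset.univ.filter fun p : V × V => s(p.1, p.2) ∈ E).card ≤ 2 * E.card := by
  refine Finset.card_le_mul_card_image_of_maps_to (f := fun p : V × V => s(p.1, p.2))
    (fun p hp => (Finset.mem_filter.1 hp).2) 2 fun e _ => ?_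
  induction e with
  | _ x y =>
  refine (Finset.card_le_card (t := {(x, y), (y, x)}) ?_).trans Finset.card_le_two
  rintro ⟨p, q⟩ hp
  simpa using (Finset.mem_filter.1 hp).2

/-- Every tree on `I` splits at each of its edges into two smaller trees. -/
theorem sum_treeSum_mul_treeSum_le {a : Sym2 V → ℝ} (ha : ∀ e, 0 ≤ a e) {I : Finset V} :
    ∑ J ∈ I.powerset, (∑ i ∈ J, ∑ j ∈ I \ J, a s(i, j)) * (treeSum a J * treeSum a (I \ J)) ≤
      2 * (I.card - 1) * treeSum a I := by
  have hL : ∑ J ∈ I.powerset,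
      (∑ i ∈ J, ∑ j ∈ I \ J, a s(i, j)) * (treeSum a J * treeSum a (I \ J)) =
      ∑ x ∈ I.powerset.sigma fun J => (J ×ˢ (I \ J)) ×ˢ
        ((Finset.univ.filter fun E : Finset (Sym2 V) => IsTreeOn J E) ×ˢ
          (Finset.univ.filter fun E : Finset (Sym2 V) => IsTreeOn (I \ J) E)),
        a s(x.2.1.1, x.2.1.2) * ((∏ e ∈ x.2.2.1, a e) * ∏ e ∈ x.2.2.2, a e) := by
    rw [Finset.sum_sigma]
    refine Finset.sum_congr rfl fun J _ => ?_
    rw [treeSum, treeSum, Finset.sum_mul_sum, ← Finset.sum_product', ← Finset.sum_product',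
      Finset.sum_mul_sum, ← Finset.sum_product']
  have hR : ∑ y ∈ (Finset.univ.filter fun E : Finset (Sym2 V) => IsTreeOn I E).sigma fun E =>
      Finset.univ.filter fun p : V × V => s(p.1, p.2) ∈ E, ∏ e ∈ y.1, a e ≤
      2 * (I.card - 1) * treeSum a I := by
    rw [Finset.sum_sigma, treeSum, Finset.mul_sum]
    refine Finset.sum_le_sum fun E hE => ?_
    simp only [Finset.sum_const, nsmul_eq_mul]
    refine mul_le_mul_of_nonneg_right ?_ (Finset.prod_nonneg fun e _ => ha e)
    have h1 := card_darts_le E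
    have h2 := (Finset.mem_filter.1 hE).2.card_edges
    rw [← h2]
    push_cast
    rw [add_sub_cancel_right]
    exact_mod_cast h1
  rw [hL]
  refine le_trans ?_ hR
  have hdisj : ∀ J : Finset V, Disjoint J (I \ J) := fun J => Finset.disjoint_sdiff
  let g : (Σ _ : Finset V, (V × V) × (Finset (Sym2 V) × Finset (Sym2 V))) →
      Σ _ : Finset (Sym2 V), V × V :=
    fun x => ⟨insert s(x.2.1.1, x.2.1.2) (x.2.2.1 ∪ x.2.2.2), x.2.1⟩
  refine sum_le_sum_of_injOn g ?_ ?_ ?_ fun _ _ => Finset.prod_nonneg fun e _ => ha e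
  · rintro ⟨J, ⟨i, j⟩, E, F⟩ hx
    simp only [Finset.mem_sigma, Finset.mem_powerset, Finset.mem_product,
      Finset.mem_filter, Finset.mem_univ, true_and, g] at hx ⊢
    obtain ⟨hJ, ⟨hi, hj⟩, hE, hF⟩ := hx
    refine ⟨?_, Finset.mem_insert_self _ _⟩
    have := hE.join hF (hdisj J) hi hj
    rwa [Finset.union_sdiff_of_subset hJ] at this
  · rintro ⟨J, ⟨i, j⟩, E, F⟩ hx ⟨J', ⟨i', j'⟩, E', F'⟩ hx' h
    simp only [Finset.coe_sigma, Set.mem_sigma_iff, Finset.mem_coe, Finset.mem_product,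
      Finset.mem_filter, Finset.mem_univ, true_and] at hx hx'
    obtain ⟨-, ⟨hi, hj⟩, hE, hF⟩ := hx
    obtain ⟨-, ⟨hi', hj'⟩, hE', hF'⟩ := hx'
    simp only [g, Sigma.mk.injEq, heq_eq_eq, Prod.mk.injEq] at h
    obtain ⟨h, rfl, rfl⟩ := h
    obtain ⟨rfl, rfl, rfl⟩ := hE.join_injective hF (hdisj J) hi hj hE' hF' (hdisj J') hi' hj' h
    rfl
  · rintro ⟨J, ⟨i, j⟩, E, F⟩ hx
    simp only [Finset.mem_sigma, Finset.mem_powerset, Finset.mem_product,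
      Finset.mem_filter, Finset.mem_univ, true_and, g] at hx ⊢
    obtain ⟨-, ⟨hi, hj⟩, hE, hF⟩ := hx
    rw [Finset.prod_insert (hE.edge_notMem_union hF (hdisj J) hi hj),
      Finset.prod_union (hE.disjoint_edges hF (hdisj J))]

end Tree

theorem prod_lt_adj_eq_prod_edges {n : ℕ} (a : Sym2 (Fin n) → ℝ) {T : SimpleGraph (Fin n)}
    {E : Finset (Sym2 (Fin n))} (hE : T.edgeSet = E) :
    ∏ p ∈ Finset.univ.filter (fun p : Fin n × Fin n => p.1 < p.2 ∧ T.Adj p.1 p.2),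
      a s(p.1, p.2) = ∏ e ∈ E, a e := by
  have hmem : ∀ x y, s(x, y) ∈ E ↔ T.Adj x y := fun x y => by
    rw [← Finset.mem_coe, ← hE, SimpleGraph.mem_edgeSet]
  refine Finset.prod_bij (fun p _ => s(p.1, p.2)) ?_ ?_ ?_ fun _ _ => rfl
  · intro p hp
    simp only [Finset.mem_filter] at hp
    exact (hmem _ _).2 hp.2.2
  · rintro ⟨p, q⟩ hp ⟨p', q'⟩ hp' h
    simp only [Finset.mem_filter] at hp hp'
    rcases Sym2.eq_iff.1 h with ⟨h1, h2⟩ | ⟨h1, h2⟩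
    · exact Prod.ext h1 h2
    · have h3 := hp.2.1
      simp only at h1 h2
      rw [h1, h2] at h3
      exact absurd h3 hp'.2.1.asymm
  · intro e he
    induction e with
    | _ x y =>
    have hxy := (hmem x y).1 he
    rcases lt_or_gt_of_ne hxy.ne with h | h
    · exact ⟨(x, y), by simp [h, hxy], rfl⟩
    · exact ⟨(y, x), by simp [h, hxy.symm], Sym2.eq_swap⟩

/-- The sum over inductively generated trees is dominated by the sum over tree graphs. -/
theorem treeSum_univ_le {n : ℕ} {a : Sym2 (Fin n) → ℝ} (ha : ∀ e, 0 ≤ a e) :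
    treeSum a Finset.univ ≤
      ∑ T ∈ Finset.univ.filter (fun T : SimpleGraph (Fin n) => T.IsTree),
        ∏ p ∈ Finset.univ.filter
            (fun p : Fin n × Fin n => p.1 < p.2 ∧ T.Adj p.1 p.2), a s(p.1, p.2) := by
  refine sum_le_sum_of_injOn (fun E => SimpleGraph.fromEdgeSet (E : Set (Sym2 (Fin n))))
    ?_ ?_ ?_ fun T _ => Finset.prod_nonneg fun p _ => ha _
  · intro E hE
    exact Finset.mem_filter.2
      ⟨Finset.mem_univ _, (Finset.mem_filter.1 hE).2.isTree_fromEdgeSet⟩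
  · intro E hE E' hE' h
    have h1 := (Finset.mem_filter.1 hE).2.edgeSet_fromEdgeSet
    have h2 := (Finset.mem_filter.1 hE').2.edgeSet_fromEdgeSet
    exact Finset.coe_injective (h1.symm.trans ((congrArg SimpleGraph.edgeSet h).trans h2))
  · intro E hE
    exact (prod_lt_adj_eq_prod_edges a (Finset.mem_filter.1 hE).2.edgeSet_fromEdgeSet).symm

theorem mem_setPartitions_univ {n : ℕ} {π : Finset (Finset (Fin n))} :
    π ∈ setPartitions Finset.univ ↔ IsSetPartition π := by
  rw [mem_setPartitions_iff_forall, IsSetPartition]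
  refine and_congr_right fun _ => ⟨?_, ?_⟩
  · rintro ⟨hd, hx⟩ i
    obtain ⟨B, hB, hiB⟩ := (hx i).1 (Finset.mem_univ i)
    exact ⟨B, ⟨hB, hiB⟩, fun C hC => hd C hC.1 B hB i hC.2 hiB⟩
  · intro h
    refine ⟨fun B hB C hC x hxB hxC => (h x).unique ⟨hB, hxB⟩ ⟨hC, hxC⟩, fun x => ?_⟩
    obtain ⟨B, hB, -⟩ := h x
    exact iff_of_true (Finset.mem_univ x) ⟨B, hB⟩

/-- If the block moments are real, the truncated expectation is the real cumulant. -/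
theorem truncExp_eq_cumulant {Ω : Type*} [MeasurableSpace Ω] (P : Measure Ω) {n : ℕ}
    (Y : Fin n → Ω → ℂ) (f : Finset (Fin n) → ℝ)
    (hf : ∀ B, ∫ ω, (∏ i ∈ B, Y i ω) ∂P = (f B : ℂ)) :
    truncExp P Y = (cumulant f Finset.univ : ℂ) := by
  have hset : Finset.univ.filter (fun π : Finset (Finset (Fin n)) => IsSetPartition π) =
      setPartitions Finset.univ := by
    ext π
    rw [mem_setPartitions_univ, Finset.mem_filter]
    simp
  rw [truncExp, hset, cumulant]
  simp only [hf, mobiusWeight]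
  push_cast
  rfl

theorem truncated_expectation_tree_bound
    {Ω : Type*} [MeasurableSpace Ω] (P : Measure Ω) [IsProbabilityMeasure P]
    (n : ℕ) (hn : 2 ≤ n) (X : Fin n → Ω → ℝ) (hXmeas : ∀ i, Measurable (X i))
    (Cov : Matrix (Fin n) (Fin n) ℝ)
    -- the `Xᵢ` are jointly centered Gaussian with covariance `Cov`
    (hgauss : ∀ c : Fin n → ℝ,
      ∫ ω, Complex.exp (Complex.I * (∑ i, c i * X i ω : ℝ)) ∂P =
        Complex.exp (-((∑ i, ∑ j, c i * c j * Cov i j : ℝ) : ℂ) / 2))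
    (hcov : ∀ i j, Cov i j = ∫ ω, X i ω * X j ω ∂P)
    (ε : Fin n → ℝ) (hε : ∀ i, ε i = 1 ∨ ε i = -1) :
    ‖truncExp P (fun i ω => Complex.exp (Complex.I * (ε i * X i ω : ℝ)))‖ ≤
      ∑ T ∈ Finset.univ.filter (fun T : SimpleGraph (Fin n) => T.IsTree),
        ∏ p ∈ Finset.univ.filter
            (fun p : Fin n × Fin n => p.1 < p.2 ∧ T.Adj p.1 p.2),
          |Cov p.1 p.2| := by
  have hsymm : ∀ i j, Cov i j = Cov j i := fun i j => by
    rw [hcov, hcov]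
    simp only [mul_comm]
  let A : Fin n → Fin n → ℝ := fun i j => ε i * ε j * Cov i j
  let a : Sym2 (Fin n) → ℝ := Sym2.lift ⟨fun i j => |Cov i j|, fun i j => congrArg abs (hsymm i j)⟩
  have ha : ∀ e, 0 ≤ a e := Sym2.ind fun i j => abs_nonneg _
  have habs : ∀ i j, |A i j| = a s(i, j) := by
    have hε₁ : ∀ i, |ε i| = 1 := fun i => by rcases hε i with h | h <;> simp [h]
    intro i j
    simp [A, a, abs_mul, hε₁]
  have hmoment : ∀ B : Finset (Fin n),
      ∫ ω, Complex.exp (Complex.I * (∑ i ∈ B, ε i * X i ω : ℝ)) ∂P =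
        (Real.exp (-coupling A B B / 2) : ℂ) := by
    intro B
    have h := hgauss fun i => if i ∈ B then ε i else 0
    simp only [ite_mul, zero_mul, mul_ite, mul_zero, Finset.sum_ite_mem, Finset.univ_inter,
      Finset.sum_ite_irrel, Finset.sum_const_zero] at h
    rw [h]
    simp [coupling, A]
  have hstable : ∀ B, 0 ≤ coupling A B B := by
    intro B
    have h : ‖∫ ω, Complex.exp (Complex.I * (∑ i ∈ B, ε i * X i ω : ℝ)) ∂P‖ ≤ 1 := by
      refine (norm_integral_le_of_norm_le_const (C := 1) (Filter.Eventually.of_forall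
        fun ω => ?_)).trans (by simp)
      rw [mul_comm, Complex.norm_exp_ofReal_mul_I]
    rw [hmoment, Complex.norm_real, Real.norm_eq_abs, abs_of_pos (Real.exp_pos _),
      Real.exp_le_one_iff] at h
    linarith
  rw [truncExp_eq_cumulant P _ (fun B => Real.exp (-(1 * coupling A B B) / 2)) ?_,
    Complex.norm_real, Real.norm_eq_abs]
  · have : Nonempty (Fin n) := ⟨⟨0, by omega⟩⟩
    have key := abs_cumulant_exp_le hstable (treeSum_nonneg ha) (one_le_treeSum_singleton ha)
      (fun I _ => le_trans (Finset.sum_le_sum fun J _ => mul_le_mul_of_nonneg_right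
        ?_ (mul_nonneg (treeSum_nonneg ha J) (treeSum_nonneg ha _)))
        (sum_treeSum_mul_treeSum_le ha)) Finset.univ_nonempty zero_le_one
    · rw [one_pow, one_mul] at key
      exact key.trans (treeSum_univ_le ha)
    · refine (Finset.abs_sum_le_sum_abs _ _).trans (Finset.sum_le_sum fun i _ => ?_)
      refine (Finset.abs_sum_le_sum_abs _ _).trans (Finset.sum_le_sum fun j _ => ?_)
      exact (habs i j).le
  · intro B
    rw [one_mul, ← hmoment]
    simp only [← Complex.exp_sum, ← Finset.mul_sum, ← Complex.ofReal_sum]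

end SommerfieldStmt7
end
end

section
/- Let Λ be a finite set, let I = {0,1} × Λ, and let (A_i)_{i∈I} be jointly centered Gaussian real random variables with covariance g(i,j) = E[A_i A_j]. Let e > 0, a > 0 and K = max_{i∈I} ∑_{j∈I} |g(i,j)|. For bounded complex random variables Y₁,…,Yₙ let 𝓔ᵀ(Y₁;…;Yₙ) = ∑_{π} (−1)^{|π|−1}(|π|−1)! ∏_{B∈π} E[∏_{i∈B}Y_i] (sum over set partitions π of {1,…,n}) denote the truncated expectation. Then for every n ≥ 2, every i₁ ∈ I and every ε₁ ∈ {−1,+1}: ∑_{i₂,…,iₙ∈I} ∑_{ε₂,…,εₙ∈{−1,+1}} |𝓔ᵀ(e^{iε₁ e a A_{i₁}}; e^{iε₂ e a A_{i₂}}; …; e^{iεₙ e a A_{iₙ}})| ≤ n^{n−2} (2 e² a² K)^{n−1}. In particular, dividing by n! and using n^{n−2} ≤ eⁿ n!, the kernels W_{n,0} of the effective fermionic interaction obtained by integrating the boson field of the lattice Sommerfield model obey, with a = γ^{−N} and |g|₁ = a²K, the bound of Theorem 1: their ℓ¹ norm is at most Cⁿ e^{2(n−1)} γ^{N(2−n)}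 |g|₁^{n−1} for an absolute constant C. -/
/-!
Statement 12: summed tree bound for the truncated expectations of boson
exponentials in the lattice Sommerfield model (Theorem 1 of the paper, m = 0):
for a centered Gaussian family `(A_i)_{i ∈ {0,1}×Λ}` with covariance `g` and
`K = max_i ∑_j |g(i,j)|`,
`∑_{i₂,…,iₙ} ∑_{ε₂,…,εₙ} |𝓔ᵀ(e^{iε₁eaA_{i₁}}; …; e^{iεₙeaA_{iₙ}})|
   ≤ n^{n−2} (2 e² a² K)^{n−1}`.
-/

open MeasureTheory Complex

open scoped Classical

noncomputable section

namespace SommerfieldStmt12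

/-- `π` is a set partition of `{1,…,n}`: its blocks are nonempty and every
index lies in exactly one block. -/
def IsSetPartition {n : ℕ} (π : Finset (Finset (Fin n))) : Prop :=
  (∀ B ∈ π, B.Nonempty) ∧ ∀ i : Fin n, ∃! B, B ∈ π ∧ i ∈ B

/-- The truncated expectation (joint cumulant)
`𝓔ᵀ(Y₁;…;Yₙ) = ∑_π (−1)^{|π|−1}(|π|−1)! ∏_{B∈π} E[∏_{i∈B} Y_i]`,
the sum running over all set partitions of `{1,…,n}`. -/
def truncExp {Ω : Type*} [MeasurableSpace Ω] (P : Measure Ω)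
    {n : ℕ} (Y : Fin n → Ω → ℂ) : ℂ :=
  ∑ π ∈ Finset.univ.filter (fun π : Finset (Finset (Fin n)) => IsSetPartition π),
    (-1 : ℂ) ^ (π.card - 1) * ((π.card - 1).factorial : ℂ) *
      ∏ B ∈ π, ∫ ω, (∏ i ∈ B, Y i ω) ∂P

/-- `π` is a partition of the finite set `S` into nonempty blocks. -/
def IsPartitionOf {α : Type*} (S : Finset α) (π : Finset (Finset α)) : Prop :=
  (∀ B ∈ π, B.Nonempty ∧ B ⊆ S) ∧ ∀ i ∈ S, ∃! B, B ∈ π ∧ i ∈ B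

/-- The finite set of all partitions of `S`. -/
def partitions {α : Type*} [DecidableEq α] (S : Finset α) : Finset (Finset (Finset α)) :=
  S.powerset.powerset.filter (IsPartitionOf S)

/-- The joint cumulant associated with the moments `φ`, indexed by finite sets. -/
def cumulant {α : Type*} [DecidableEq α] (φ : Finset α → ℝ) (S : Finset α) : ℝ :=
  ∑ π ∈ partitions S,
    (-1 : ℝ) ^ (π.card - 1) * ((π.card - 1).factorial : ℝ) * ∏ B ∈ π, φ B

section Partitions

variable {α : Type*}

lemma IsPartitionOf.eq_of_mem {S : Finset α} {π : Finset (Finset α)} (h : IsPartitionOf S π)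
    {B C : Finset α} (hB : B ∈ π) (hC : C ∈ π) {i : α} (hiB : i ∈ B) (hiC : i ∈ C) : B = C :=
  (h.2 i ((h.1 B hB).2 hiB)).unique ⟨hB, hiB⟩ ⟨hC, hiC⟩

lemma isPartitionOf_singleton {S : Finset α} (hS : S.Nonempty) : IsPartitionOf S {S} := by
  refine ⟨fun B hB => ?_, fun i hi => ⟨S, ⟨Finset.mem_singleton_self S, hi⟩, fun B hB => ?_⟩⟩
  · rw [Finset.mem_singleton.1 hB]
    exact ⟨hS, subset_rfl⟩
  · exact Finset.mem_singleton.1 hB.1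

lemma IsPartitionOf.eq_singleton_of_card {S : Finset α} {π : Finset (Finset α)}
    (h : IsPartitionOf S π) (hcard : π.card = 1) : π = {S} := by
  obtain ⟨B, rfl⟩ := Finset.card_eq_one.1 hcard
  congr 1
  refine (h.1 B (Finset.mem_singleton_self B)).2.antisymm fun i hi => ?_
  obtain ⟨C, ⟨hC, hiC⟩, -⟩ := h.2 i hi
  rwa [Finset.mem_singleton.1 hC] at hiC

lemma IsPartitionOf.card_pos {S : Finset α} {π : Finset (Finset α)}
    (h : IsPartitionOf S π) (hS : S.Nonempty) : 0 < π.card := by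
  obtain ⟨i, hi⟩ := hS
  obtain ⟨B, ⟨hB, -⟩, -⟩ := h.2 i hi
  exact Finset.card_pos.2 ⟨B, hB⟩

variable [DecidableEq α]

lemma mem_partitions {S : Finset α} {π : Finset (Finset α)} :
    π ∈ partitions S ↔ IsPartitionOf S π := by
  simp only [partitions, Finset.mem_filter, Finset.mem_powerset, and_iff_right_iff_imp]
  intro h B hB
  exact Finset.mem_powerset.2 (h.1 B hB).2

lemma IsPartitionOf.insert_sdiff {S A : Finset α} {π : Finset (Finset α)}
    (h : IsPartitionOf A π) (hA : A ⊂ S) : IsPartitionOf S (insert (S \ A) π) := by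
  have hne : (S \ A).Nonempty := Finset.sdiff_nonempty.2 hA.2
  refine ⟨fun B hB => ?_, fun i hi => ?_⟩
  · rcases Finset.mem_insert.1 hB with rfl | hB
    · exact ⟨hne, Finset.sdiff_subset⟩
    · exact ⟨(h.1 B hB).1, (h.1 B hB).2.trans hA.1⟩
  · by_cases hiA : i ∈ A
    · obtain ⟨B, ⟨hB, hiB⟩, hu⟩ := h.2 i hiA
      refine ⟨B, ⟨Finset.mem_insert_of_mem hB, hiB⟩, ?_⟩
      rintro C ⟨hC, hiC⟩
      rcases Finset.mem_insert.1 hC with rfl | hC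
      · exact absurd hiA (Finset.mem_sdiff.1 hiC).2
      · exact hu C ⟨hC, hiC⟩
    · refine ⟨S \ A, ⟨Finset.mem_insert_self _ _, Finset.mem_sdiff.2 ⟨hi, hiA⟩⟩, ?_⟩
      rintro C ⟨hC, hiC⟩
      rcases Finset.mem_insert.1 hC with rfl | hC
      · rfl
      · exact absurd ((h.1 C hC).2 hiC) hiA

lemma IsPartitionOf.sdiff_notMem {S A : Finset α} {π : Finset (Finset α)}
    (h : IsPartitionOf A π) (hA : A ⊂ S) : S \ A ∉ π := by
  intro hmem
  obtain ⟨i, hi⟩ := Finset.sdiff_nonempty.2 hA.2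
  exact (Finset.mem_sdiff.1 hi).2 ((h.1 _ hmem).2 hi)

lemma IsPartitionOf.erase {S B : Finset α} {π : Finset (Finset α)}
    (h : IsPartitionOf S π) (hB : B ∈ π) : IsPartitionOf (S \ B) (π.erase B) := by
  refine ⟨fun C hC => ?_, fun i hi => ?_⟩
  · obtain ⟨hCB, hC⟩ := Finset.mem_erase.1 hC
    refine ⟨(h.1 C hC).1, fun i hi => Finset.mem_sdiff.2 ⟨(h.1 C hC).2 hi, fun hiB => hCB ?_⟩⟩
    exact h.eq_of_mem hC hB hi hiB
  · obtain ⟨hiS, hiB⟩ := Finset.mem_sdiff.1 hi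
    obtain ⟨C, ⟨hC, hiC⟩, hu⟩ := h.2 i hiS
    refine ⟨C, ⟨Finset.mem_erase.2 ⟨?_, hC⟩, hiC⟩, ?_⟩
    · rintro rfl
      exact hiB hiC
    · rintro D ⟨hD, hiD⟩
      exact hu D ⟨Finset.mem_of_mem_erase hD, hiD⟩

lemma IsPartitionOf.card_filter_notMem {S : Finset α} {π : Finset (Finset α)}
    (h : IsPartitionOf S π) {r : α} (hr : r ∈ S) :
    (π.filter (fun B => r ∉ B)).card = π.card - 1 := by
  obtain ⟨B, ⟨hB, hrB⟩, hu⟩ := h.2 r hr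
  have : π.filter (fun B => r ∉ B) = π.erase B := by
    ext C
    simp only [Finset.mem_filter, Finset.mem_erase]
    refine ⟨fun ⟨hC, hrC⟩ => ⟨fun hCB => hrC (hCB ▸ hrB), hC⟩, fun ⟨hCB, hC⟩ => ⟨hC, fun hrC => ?_⟩⟩
    exact hCB (hu C ⟨hC, hrC⟩)
  rw [this, Finset.card_erase_of_mem hB]

/-- Removing a block that avoids `r` identifies partitions of `S` with a marked block
with partitions of proper subsets of `S` containing `r`. -/
lemma sum_cumulant_ssubsets (φ : Finset α → ℝ) {S : Finset α} {r : α} (hr : r ∈ S) :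
    ∑ A ∈ S.ssubsets.filter (fun A => r ∈ A), cumulant φ A * φ (S \ A) =
      ∑ π ∈ partitions S, ((π.card - 1 : ℕ) : ℝ) *
        ((-1 : ℝ) ^ (π.card - 1 - 1) * ((π.card - 1 - 1).factorial : ℝ)) * ∏ B ∈ π, φ B := by
  have hcount : ∀ π ∈ partitions S, ((π.card - 1 : ℕ) : ℝ) *
        ((-1 : ℝ) ^ (π.card - 1 - 1) * ((π.card - 1 - 1).factorial : ℝ)) * ∏ B ∈ π, φ B =
      ∑ _C ∈ π.filter (fun B => r ∉ B),
        ((-1 : ℝ) ^ (π.card - 1 - 1) * ((π.card - 1 - 1).factorial : ℝ)) * ∏ B ∈ π, φ B := by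
    intro π hπ
    rw [Finset.sum_const, (mem_partitions.1 hπ).card_filter_notMem hr, nsmul_eq_mul, mul_assoc]
  rw [Finset.sum_congr rfl hcount]
  simp only [cumulant, Finset.sum_mul]
  rw [Finset.sum_sigma', Finset.sum_sigma']
  refine Finset.sum_bij' (fun x _ => ⟨insert (S \ x.1) x.2, S \ x.1⟩)
    (fun y _ => ⟨S \ y.2, y.1.erase y.2⟩) ?_ ?_ ?_ ?_ ?_
  · rintro ⟨A, π⟩ h
    simp only [Finset.mem_sigma, Finset.mem_filter, Finset.mem_ssubsets, mem_partitions] at h ⊢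
    exact ⟨h.2.insert_sdiff h.1.1, Finset.mem_insert_self _ _,
      fun hrA => (Finset.mem_sdiff.1 hrA).2 h.1.2⟩
  · rintro ⟨π, B⟩ h
    simp only [Finset.mem_sigma, Finset.mem_filter, Finset.mem_ssubsets, mem_partitions] at h ⊢
    obtain ⟨hπ, hB, hrB⟩ := h
    refine ⟨⟨?_, Finset.mem_sdiff.2 ⟨hr, hrB⟩⟩, hπ.erase hB⟩
    exact Finset.sdiff_ssubset (hπ.1 B hB).2 (hπ.1 B hB).1
  · rintro ⟨A, π⟩ h
    simp only [Finset.mem_sigma, Finset.mem_filter, Finset.mem_ssubsets, mem_partitions] at h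
    simp [Finset.sdiff_sdiff_eq_self h.1.1.1, Finset.erase_insert (h.2.sdiff_notMem h.1.1)]
  · rintro ⟨π, B⟩ h
    simp only [Finset.mem_sigma, Finset.mem_filter, mem_partitions] at h
    obtain ⟨hπ, hB, hrB⟩ := h
    simp [Finset.sdiff_sdiff_eq_self (hπ.1 B hB).2, Finset.insert_erase hB]
  · rintro ⟨A, π⟩ h
    simp only [Finset.mem_sigma, Finset.mem_filter, Finset.mem_ssubsets, mem_partitions] at h
    have hn := h.2.sdiff_notMem h.1.1
    simp only [Finset.prod_insert hn, Finset.card_insert_of_notMem hn, Nat.add_sub_cancel]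
    ring

lemma powerset_filter_mem_eq_insert {S : Finset α} {r : α} (hr : r ∈ S) :
    S.powerset.filter (fun A => r ∈ A) = insert S (S.ssubsets.filter (fun A => r ∈ A)) := by
  ext A
  simp only [Finset.mem_filter, Finset.mem_powerset, Finset.mem_insert, Finset.mem_ssubsets,
    Finset.ssubset_iff_subset_ne]
  by_cases h : A = S
  · simp [h, hr]
  · simp [h]

/-- Isolating the block that contains `r` expresses moments through cumulants. -/
lemma sum_cumulant_mul_moment (φ : Finset α → ℝ) (hφ : φ ∅ = 1) {S : Finset α} {r : α}
    (hr : r ∈ S) :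
    ∑ A ∈ S.powerset.filter (fun A => r ∈ A), cumulant φ A * φ (S \ A) = φ S := by
  rw [powerset_filter_mem_eq_insert hr, Finset.sum_insert (by simp), sum_cumulant_ssubsets φ hr, Finset.sdiff_self, hφ,
    mul_one, cumulant, ← Finset.sum_add_distrib]
  rw [Finset.sum_eq_single_of_mem {S} (mem_partitions.2 (isPartitionOf_singleton ⟨r, hr⟩))]
  · simp
  · intro π hπ hne
    have h := mem_partitions.1 hπ
    obtain ⟨k, hk⟩ : ∃ k, π.card = k + 2 := by
      have h₀ := h.card_pos ⟨r, hr⟩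
      have h₁ : π.card ≠ 1 := fun h₁ => hne (h.eq_singleton_of_card h₁)
      exact ⟨π.card - 2, by omega⟩
    simp only [hk, Nat.add_sub_cancel, show k + 2 - 1 = k + 1 from rfl, Nat.factorial_succ]
    push_cast
    ring

end Partitions

section Abel

/-- The `n`-th alternating binomial sum of a power smaller than `n` vanishes. -/
lemma alternating_sum_choose_mul_pow (m : ℕ) :
    ∑ k ∈ Finset.range (m + 2),
      ((m + 2).choose (k + 1) : ℝ) * ((k : ℝ) + 1) ^ k * (-((k : ℝ) + 1)) ^ (m + 1 - k) = 0 := by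
  have h := congrFun (fwdDiff_iter_pow_eq_zero_of_lt (R := ℝ) (Nat.lt_succ_self (m + 1))) 0
  rw [fwdDiff_iter_eq_sum_shift, Finset.sum_range_succ'] at h
  simp only [Pi.zero_apply, zero_add, nsmul_eq_mul, mul_one, zero_smul, zsmul_eq_mul] at h
  rw [show (0 : ℝ) ^ (m + 1) = 0 by simp, mul_zero, add_zero] at h
  rw [← h]
  refine Finset.sum_congr rfl fun k hk => ?_
  have hk' : k ≤ m + 1 := by have := Finset.mem_range.1 hk; omega
  rw [neg_pow, show m + 1 + 1 - (k + 1) = m + 1 - k by omega]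
  have : ((k : ℝ) + 1) ^ (m + 1) = ((k : ℝ) + 1) ^ k * ((k : ℝ) + 1) ^ (m + 1 - k) := by
    rw [← pow_add]; congr 1; omega
  push_cast
  rw [this]
  ring

/-- A form of Abel's binomial identity. -/
lemma abel_sum (m : ℕ) (y : ℝ) :
    ∑ k ∈ Finset.range (m + 1),
      ((m + 1).choose (k + 1) : ℝ) * ((k : ℝ) + 1) ^ k * (y - ((k : ℝ) + 1)) ^ (m - k) =
      ((m : ℝ) + 1) * y ^ m := by
  induction m generalizing y with
  | zero => simp
  | succ m ih =>
    set F : ℝ → ℝ := fun y => ∑ k ∈ Finset.range (m + 2),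
      ((m + 2).choose (k + 1) : ℝ) * ((k : ℝ) + 1) ^ k * (y - ((k : ℝ) + 1)) ^ (m + 1 - k) -
      ((m : ℝ) + 2) * y ^ (m + 1) with hF
    have hderiv : ∀ y, HasDerivAt F 0 y := by
      intro y
      have hsum : HasDerivAt (fun y : ℝ => ∑ k ∈ Finset.range (m + 2),
          ((m + 2).choose (k + 1) : ℝ) * ((k : ℝ) + 1) ^ k * (y - ((k : ℝ) + 1)) ^ (m + 1 - k))
          (∑ k ∈ Finset.range (m + 2), ((m + 2).choose (k + 1) : ℝ) * ((k : ℝ) + 1) ^ k *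
            (((m + 1 - k : ℕ) : ℝ) * (y - ((k : ℝ) + 1)) ^ (m + 1 - k - 1) * 1)) y :=
        HasDerivAt.fun_sum fun k _ =>
          (((hasDerivAt_id y).sub_const ((k : ℝ) + 1)).pow (m + 1 - k)).const_mul _
      have hpow := (hasDerivAt_pow (m + 1) y).const_mul ((m : ℝ) + 2)
      refine (hsum.sub hpow).congr_deriv ?_
      rw [Finset.sum_range_succ, Nat.sub_self, sub_eq_zero]
      simp only [Nat.cast_zero, zero_mul, mul_zero, add_zero, mul_one]
      have : ((m : ℝ) + 2) * (((m + 1 : ℕ) : ℝ) * y ^ (m + 1 - 1)) =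
          ((m : ℝ) + 2) * (((m : ℝ) + 1) * y ^ m) := by
        push_cast; rfl
      rw [this, ← ih y, Finset.mul_sum]
      refine Finset.sum_congr rfl fun k hk => ?_
      have hk' : k ≤ m := by have := Finset.mem_range.1 hk; omega
      have hc := Nat.choose_mul_succ_eq (m + 1) (k + 1)
      have hc' : ((m + 1).choose (k + 1) : ℝ) * ((m : ℝ) + 2) =
          ((m + 2).choose (k + 1) : ℝ) * ((m + 1 - k : ℕ) : ℝ) := by
        rw [show m + 1 + 1 - (k + 1) = m + 1 - k by omega] at hc
        exact_mod_cast hc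
      rw [show m + 1 - k - 1 = m - k by omega]
      linear_combination (-((k : ℝ) + 1) ^ k * (y - ((k : ℝ) + 1)) ^ (m - k)) * hc'
    have hconst := is_const_of_deriv_eq_zero (fun y => (hderiv y).differentiableAt)
      (fun y => (hderiv y).deriv) y 0
    have hzero : F 0 = 0 := by
      simp only [hF, zero_sub]
      rw [alternating_sum_choose_mul_pow]
      simp
    rw [hzero] at hconst
    have := sub_eq_zero.1 hconst
    push_cast
    rw [show m + 1 + 1 = m + 2 from rfl, this]
    ring

/-- Splitting a labelled tree along one of its edges, at the level of cardinalities. -/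
lemma abel_sum_splittings (m : ℕ) :
    ∑ k ∈ Finset.range (m + 1),
      ((m + 2).choose (k + 1) : ℝ) * ((k : ℝ) + 1) ^ k * (((m - k : ℕ) : ℝ) + 1) ^ (m - k) =
      2 * ((m : ℝ) + 1) * ((m : ℝ) + 2) ^ m := by
  set s : ℕ → ℝ := fun k =>
    ((m + 2).choose (k + 1) : ℝ) * ((k : ℝ) + 1) ^ k * (((m - k : ℕ) : ℝ) + 1) ^ (m - k) with hs
  have h₁ : ∑ k ∈ Finset.range (m + 1), s k * (((m - k : ℕ) : ℝ) + 1) =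
      ((m : ℝ) + 1) * ((m : ℝ) + 2) ^ (m + 1) := by
    have h := abel_sum (m + 1) ((m : ℝ) + 2)
    rw [Finset.sum_range_succ] at h
    have hlast : ((m + 1 + 1).choose (m + 1 + 1) : ℝ) * (((m + 1 : ℕ) : ℝ) + 1) ^ (m + 1) *
        ((m : ℝ) + 2 - (((m + 1 : ℕ) : ℝ) + 1)) ^ (m + 1 - (m + 1)) =
        ((m : ℝ) + 2) ^ (m + 1) := by
      rw [Nat.choose_self, Nat.sub_self]
      push_cast
      ring
    rw [hlast] at h
    have hsum : ∑ k ∈ Finset.range (m + 1), s k * (((m - k : ℕ) : ℝ) + 1) =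
        ∑ k ∈ Finset.range (m + 1), ((m + 1 + 1).choose (k + 1) : ℝ) * ((k : ℝ) + 1) ^ k *
          ((m : ℝ) + 2 - ((k : ℝ) + 1)) ^ (m + 1 - k) := by
      refine Finset.sum_congr rfl fun k hk => ?_
      have hk' : k ≤ m := by have := Finset.mem_range.1 hk; omega
      rw [show m + 1 - k = m - k + 1 by omega, pow_succ,
        show (m : ℝ) + 2 - ((k : ℝ) + 1) = ((m - k : ℕ) : ℝ) + 1 by
          rw [Nat.cast_sub hk']; ring]
      simp only [hs]
      ring
    rw [hsum]
    push_cast at h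
    linear_combination h
  have h₂ : ∑ k ∈ Finset.range (m + 1), s k * ((k : ℝ) + 1) =
      ((m : ℝ) + 1) * ((m : ℝ) + 2) ^ (m + 1) := by
    rw [← h₁, ← Finset.sum_range_reflect]
    refine Finset.sum_congr rfl fun k hk => ?_
    have hk' : k ≤ m := by have := Finset.mem_range.1 hk; omega
    simp only [hs, show m + 1 - 1 - k = m - k by omega, Nat.sub_sub_self hk']
    rw [← Nat.choose_symm (show k + 1 ≤ m + 2 by omega),
      show m + 2 - (k + 1) = m - k + 1 by omega]
    ring
  have hpos : (m : ℝ) + 2 ≠ 0 := by positivity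
  refine mul_right_cancel₀ hpos ?_
  have hadd : (∑ k ∈ Finset.range (m + 1), s k) * ((m : ℝ) + 2) =
      ∑ k ∈ Finset.range (m + 1), s k * (((m - k : ℕ) : ℝ) + 1) +
        ∑ k ∈ Finset.range (m + 1), s k * ((k : ℝ) + 1) := by
    rw [Finset.sum_mul, ← Finset.sum_add_distrib]
    refine Finset.sum_congr rfl fun k hk => ?_
    have hk' : k ≤ m := by have := Finset.mem_range.1 hk; omega
    rw [Nat.cast_sub hk']
    ring
  rw [hadd, h₁, h₂]
  ring

lemma sum_powerset_tree_count {α : Type*} [DecidableEq α] (S : Finset α) (hS : 2 ≤ S.card) :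
    ∑ A ∈ S.powerset,
      ((A.card : ℝ) * (A.card : ℝ) ^ (A.card - 2)) *
        (((S \ A).card : ℝ) * ((S \ A).card : ℝ) ^ ((S \ A).card - 2)) =
      2 * ((S.card - 1 : ℕ) : ℝ) * (S.card : ℝ) ^ (S.card - 2) := by
  obtain ⟨m, hm⟩ : ∃ m, S.card = m + 2 := ⟨S.card - 2, by omega⟩
  have hcard : ∀ A ∈ S.powerset, (S \ A).card = S.card - A.card := fun A hA =>
    Finset.card_sdiff_of_subset (Finset.mem_powerset.1 hA)
  rw [Finset.sum_congr rfl fun A hA => by rw [hcard A hA]]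
  rw [Finset.sum_powerset_apply_card (fun k : ℕ => ((k : ℝ) * (k : ℝ) ^ (k - 2)) *
    (((S.card - k : ℕ) : ℝ) * ((S.card - k : ℕ) : ℝ) ^ (S.card - k - 2)))]
  rw [hm, Finset.sum_range_succ, Finset.sum_range_succ']
  simp only [Nat.sub_self, Nat.cast_zero, zero_mul, mul_zero, smul_zero, add_zero,
    Nat.add_sub_cancel, show m + 2 - 1 = m + 1 from rfl]
  have h := abel_sum_splittings m
  push_cast
  rw [← h]
  refine Finset.sum_congr rfl fun k hk => ?_
  have hk' : k ≤ m := by have := Finset.mem_range.1 hk; omega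
  have hpow : ∀ j : ℕ, (((j + 1 : ℕ) : ℝ)) * ((j + 1 : ℕ) : ℝ) ^ (j + 1 - 2) =
      ((j : ℝ) + 1) ^ j := by
    intro j
    cases j with
    | zero => simp
    | succ j =>
      rw [show j + 1 + 1 - 2 = j by omega]
      push_cast
      ring
  have h₁ := hpow k
  have h₂ := hpow (m - k)
  rw [show m - k + 1 = m + 1 - k by omega] at h₂
  push_cast at h₁
  rw [h₁, h₂, nsmul_eq_mul]
  ring

end Abel

/-- The total interaction `∑_{i ∈ A} ∑_{j ∈ B} M i j` between two finite sets. -/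
def pairSum {α : Type*} (M : α → α → ℝ) (A B : Finset α) : ℝ :=
  ∑ i ∈ A, ∑ j ∈ B, M i j

/-- The Gaussian moments `exp (-t/2 ∑_{i,j ∈ B} M i j)`. -/
def gaussMoment {α : Type*} (M : α → α → ℝ) (t : ℝ) (B : Finset α) : ℝ :=
  Real.exp (-(t * pairSum M B B / 2))

section Flow

variable {α : Type*}

@[simp] lemma pairSum_empty_left (M : α → α → ℝ) (B : Finset α) : pairSum M ∅ B = 0 := by
  simp [pairSum]

@[simp] lemma pairSum_empty_right (M : α → α → ℝ) (A : Finset α) : pairSum M A ∅ = 0 := by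
  simp [pairSum]

lemma pairSum_comm {M : α → α → ℝ} (hM : ∀ i j, M i j = M j i) (A B : Finset α) :
    pairSum M A B = pairSum M B A := by
  rw [pairSum, Finset.sum_comm]
  exact Finset.sum_congr rfl fun i _ => Finset.sum_congr rfl fun j _ => hM j i

lemma abs_pairSum_le (M : α → α → ℝ) (A B : Finset α) :
    |pairSum M A B| ≤ pairSum (fun i j => |M i j|) A B :=
  (Finset.abs_sum_le_sum_abs _ _).trans
    (Finset.sum_le_sum fun _ _ => Finset.abs_sum_le_sum_abs _ _)

lemma pairSum_nonneg {M : α → α → ℝ} (hM : ∀ i j, 0 ≤ M i j) (A B : Finset α) :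
    0 ≤ pairSum M A B :=
  Finset.sum_nonneg fun i _ => Finset.sum_nonneg fun j _ => hM i j

@[simp] lemma gaussMoment_empty (M : α → α → ℝ) (t : ℝ) : gaussMoment M t ∅ = 1 := by
  simp [gaussMoment]

lemma hasDerivAt_gaussMoment (M : α → α → ℝ) (t : ℝ) (B : Finset α) :
    HasDerivAt (fun t => gaussMoment M t B)
      (-(1 / 2) * pairSum M B B * gaussMoment M t B) t := by
  have h : HasDerivAt (fun t : ℝ => -(t * pairSum M B B / 2)) (-(1 * pairSum M B B / 2)) t :=
    (((hasDerivAt_id t).mul_const _).div_const 2).neg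
  refine h.exp.congr_deriv ?_
  rw [gaussMoment]
  ring

variable [DecidableEq α]

lemma pairSum_self_eq_add_sdiff {M : α → α → ℝ} (hM : ∀ i j, M i j = M j i) {A S : Finset α}
    (hA : A ⊆ S) :
    pairSum M S S =
      pairSum M A A + pairSum M (S \ A) (S \ A) + 2 * pairSum M A (S \ A) := by
  have hleft : ∀ B, pairSum M S B = pairSum M (S \ A) B + pairSum M A B := fun B =>
    (Finset.sum_sdiff hA).symm
  rw [hleft S, pairSum_comm hM (S \ A) S, pairSum_comm hM A S, hleft (S \ A), hleft A,
    pairSum_comm hM (S \ A) A]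
  ring

lemma sum_pairSum_mul_cumulant (M : α → α → ℝ) {φ κ : Finset α → ℝ}
    (hκ : ∀ U : Finset α, ∀ j ∈ U,
      ∑ C ∈ U.powerset.filter (fun C => j ∈ C), κ C * φ (U \ C) = φ U) (B U : Finset α) :
    ∑ C ∈ U.powerset, pairSum M B C * κ C * φ (U \ C) = pairSum M B U * φ U := by
  have hright : ∀ C, pairSum M B C = ∑ j ∈ C, ∑ i ∈ B, M i j := fun C => Finset.sum_comm
  calc _ = ∑ C ∈ U.powerset, ∑ j ∈ C, (∑ i ∈ B, M i j) * (κ C * φ (U \ C)) :=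
        Finset.sum_congr rfl fun C _ => by rw [hright, ← Finset.sum_mul, mul_assoc]
    _ = ∑ j ∈ U, ∑ C ∈ U.powerset.filter (fun C => j ∈ C),
          (∑ i ∈ B, M i j) * (κ C * φ (U \ C)) := by
        refine Finset.sum_comm' fun C j => ?_
        simp only [Finset.mem_powerset, Finset.mem_filter]
        exact ⟨fun h => ⟨⟨h.1, h.2⟩, h.1 h.2⟩, fun h => h.1⟩
    _ = _ := by
        rw [hright, Finset.sum_mul]
        exact Finset.sum_congr rfl fun j hj => by rw [← Finset.mul_sum, hκ U j hj]

lemma sum_powerset_eq_two_mul {h : Finset α → Finset α → ℝ} (hh : ∀ B C, h B C = h C B)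
    {A : Finset α} {r : α} (hr : r ∈ A) :
    ∑ B ∈ A.powerset, h B (A \ B) =
      2 * ∑ B ∈ A.powerset.filter (fun B => r ∈ B), h B (A \ B) := by
  rw [← Finset.sum_filter_add_sum_filter_not A.powerset (fun B => r ∈ B), two_mul]
  congr 1
  refine Finset.sum_bij' (fun B _ => A \ B) (fun B _ => A \ B) ?_ ?_ ?_ ?_ ?_
  · intro B hB
    simp only [Finset.mem_filter, Finset.mem_powerset, Finset.mem_sdiff] at hB ⊢
    exact ⟨Finset.sdiff_subset, hr, hB.2⟩
  · intro B hB
    simp only [Finset.mem_filter, Finset.mem_powerset, Finset.mem_sdiff] at hB ⊢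
    exact ⟨Finset.sdiff_subset, fun h => h.2 hB.2⟩
  · intro B hB
    exact Finset.sdiff_sdiff_eq_self (Finset.mem_powerset.1 (Finset.mem_filter.1 hB).1)
  · intro B hB
    exact Finset.sdiff_sdiff_eq_self (Finset.mem_powerset.1 (Finset.mem_filter.1 hB).1)
  · intro B hB
    rw [Finset.sdiff_sdiff_eq_self (Finset.mem_powerset.1 (Finset.mem_filter.1 hB).1), hh]

lemma sum_powerset_nested (f : Finset α → Finset α → Finset α → ℝ) (S : Finset α) (r : α) :
    ∑ A ∈ S.powerset.filter (fun A => r ∈ A), ∑ B ∈ A.powerset.filter (fun B => r ∈ B),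
        f B (A \ B) (S \ A) =
      ∑ B ∈ S.powerset.filter (fun B => r ∈ B), ∑ C ∈ (S \ B).powerset,
        f B C ((S \ B) \ C) := by
  rw [Finset.sum_sigma', Finset.sum_sigma']
  refine Finset.sum_bij' (fun x _ => ⟨x.2, x.1 \ x.2⟩) (fun y _ => ⟨y.1 ∪ y.2, y.1⟩)
    ?_ ?_ ?_ ?_ ?_
  · rintro ⟨A, B⟩ h
    simp only [Finset.mem_sigma, Finset.mem_filter, Finset.mem_powerset] at h ⊢
    exact ⟨⟨h.2.1.trans h.1.1, h.2.2⟩, Finset.sdiff_subset_sdiff h.1.1 subset_rfl⟩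
  · rintro ⟨B, C⟩ h
    simp only [Finset.mem_sigma, Finset.mem_filter, Finset.mem_powerset] at h ⊢
    exact ⟨⟨Finset.union_subset h.1.1 (h.2.trans Finset.sdiff_subset),
      Finset.mem_union_left _ h.1.2⟩, Finset.subset_union_left, h.1.2⟩
  · rintro ⟨A, B⟩ h
    simp only [Finset.mem_sigma, Finset.mem_filter, Finset.mem_powerset] at h
    simp [Finset.union_sdiff_of_subset h.2.1]
  · rintro ⟨B, C⟩ h
    simp only [Finset.mem_sigma, Finset.mem_filter, Finset.mem_powerset] at h
    have hd : Disjoint C B := (Finset.subset_sdiff.1 h.2).2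
    simp [Finset.union_sdiff_left, Finset.sdiff_eq_self_of_disjoint hd]
  · rintro ⟨A, B⟩ h
    simp only [Finset.mem_sigma, Finset.mem_filter, Finset.mem_powerset] at h
    have : (S \ B) \ (A \ B) = S \ A := by
      rw [Finset.sdiff_sdiff_left', ← Finset.sdiff_union_distrib,
        Finset.union_sdiff_of_subset h.2.1]
    simp only [this]

/-- The right-hand side of the flow equation for the Gaussian cumulants. -/
def flowRate (M : α → α → ℝ) (κ : Finset α → ℝ) (S : Finset α) : ℝ :=
  -(1 / 2) * pairSum M S S * κ S -
    (1 / 2) * ∑ A ∈ S.powerset, pairSum M A (S \ A) * κ A * κ (S \ A)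

lemma sum_flowRate {M : α → α → ℝ} (hM : ∀ i j, M i j = M j i) {φ κ : Finset α → ℝ}
    (hκ : ∀ U : Finset α, ∀ j ∈ U,
      ∑ C ∈ U.powerset.filter (fun C => j ∈ C), κ C * φ (U \ C) = φ U)
    {S : Finset α} {r : α} (hr : r ∈ S) :
    ∑ A ∈ S.powerset.filter (fun A => r ∈ A),
      (flowRate M κ A * φ (S \ A) +
        κ A * (-(1 / 2) * pairSum M (S \ A) (S \ A) * φ (S \ A))) =
      -(1 / 2) * pairSum M S S * φ S := by
  have hquad : ∑ A ∈ S.powerset.filter (fun A => r ∈ A),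
      (1 / 2) * (∑ B ∈ A.powerset, pairSum M B (A \ B) * κ B * κ (A \ B)) * φ (S \ A) =
      ∑ A ∈ S.powerset.filter (fun A => r ∈ A), pairSum M A (S \ A) * κ A * φ (S \ A) := by
    calc _ = ∑ A ∈ S.powerset.filter (fun A => r ∈ A),
          ∑ B ∈ A.powerset.filter (fun B => r ∈ B),
            pairSum M B (A \ B) * κ B * κ (A \ B) * φ (S \ A) := by
          refine Finset.sum_congr rfl fun A hA => ?_
          rw [sum_powerset_eq_two_mul (h := fun B C => pairSum M B C * κ B * κ C)
            (fun B C => by rw [pairSum_comm hM]; ring) (Finset.mem_filter.1 hA).2,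
            ← Finset.sum_mul]
          ring
      _ = ∑ B ∈ S.powerset.filter (fun B => r ∈ B), ∑ C ∈ (S \ B).powerset,
            pairSum M B C * κ B * κ C * φ ((S \ B) \ C) :=
          sum_powerset_nested (fun B C D => pairSum M B C * κ B * κ C * φ D) S r
      _ = _ := by
          refine Finset.sum_congr rfl fun B _ => ?_
          rw [mul_right_comm, ← sum_pairSum_mul_cumulant M hκ, Finset.sum_mul]
          exact Finset.sum_congr rfl fun C _ => by ring
  rw [← hκ S r hr, Finset.mul_sum, ← sub_eq_zero, ← Finset.sum_sub_distrib]
  have hterm : ∀ A ∈ S.powerset.filter (fun A => r ∈ A),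
      flowRate M κ A * φ (S \ A) + κ A * (-(1 / 2) * pairSum M (S \ A) (S \ A) * φ (S \ A)) -
        -(1 / 2) * pairSum M S S * (κ A * φ (S \ A)) =
      pairSum M A (S \ A) * κ A * φ (S \ A) -
        (1 / 2) * (∑ B ∈ A.powerset, pairSum M B (A \ B) * κ B * κ (A \ B)) * φ (S \ A) := by
    intro A hA
    rw [pairSum_self_eq_add_sdiff hM (Finset.mem_powerset.1 (Finset.mem_filter.1 hA).1), flowRate]
    ring
  rw [Finset.sum_congr rfl hterm, Finset.sum_sub_distrib, hquad, sub_self]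

lemma cumulant_eq_sub (φ : Finset α → ℝ) (hφ : φ ∅ = 1) {S : Finset α} {r : α} (hr : r ∈ S) :
    cumulant φ S =
      φ S - ∑ A ∈ S.ssubsets.filter (fun A => r ∈ A), cumulant φ A * φ (S \ A) := by
  rw [← sum_cumulant_mul_moment φ hφ hr, powerset_filter_mem_eq_insert hr,
    Finset.sum_insert (by simp)]
  simp [hφ]

/-- The flow equation for the cumulants of a Gaussian family with scaled covariance. -/
lemma hasDerivAt_cumulant {M : α → α → ℝ} (hM : ∀ i j, M i j = M j i) (t : ℝ)
    (S : Finset α) (hS : S.Nonempty) :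
    HasDerivAt (fun t => cumulant (gaussMoment M t) S)
      (flowRate M (cumulant (gaussMoment M t)) S) t := by
  induction S using Finset.strongInduction with
  | H S ih =>
    obtain ⟨r, hr⟩ := hS
    have heq : (fun t => cumulant (gaussMoment M t) S) = fun t => gaussMoment M t S -
        ∑ A ∈ S.ssubsets.filter (fun A => r ∈ A),
          cumulant (gaussMoment M t) A * gaussMoment M t (S \ A) :=
      funext fun t => cumulant_eq_sub _ (gaussMoment_empty M t) hr
    rw [heq]
    have hsum := HasDerivAt.fun_sum fun A (hA : A ∈ S.ssubsets.filter (fun A => r ∈ A)) =>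
      (ih A (Finset.mem_ssubsets.1 (Finset.mem_filter.1 hA).1)
        ⟨r, (Finset.mem_filter.1 hA).2⟩).mul (hasDerivAt_gaussMoment M t (S \ A))
    refine ((hasDerivAt_gaussMoment M t S).sub hsum).congr_deriv ?_
    have h := sum_flowRate hM (fun U j hj =>
      sum_cumulant_mul_moment (gaussMoment M t) (gaussMoment_empty M t) hj) hr
    rw [powerset_filter_mem_eq_insert hr, Finset.sum_insert (by simp)] at h
    simp only [Finset.sdiff_self, gaussMoment_empty, pairSum_empty_left, mul_zero,
      add_zero, mul_one] at h
    linarith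

lemma cumulant_singleton (φ : Finset α → ℝ) (hφ : φ ∅ = 1) (r : α) :
    cumulant φ {r} = φ {r} := by
  rw [cumulant_eq_sub φ hφ (Finset.mem_singleton_self r), sub_eq_self]
  refine Finset.sum_eq_zero fun A hA => ?_
  simp only [Finset.mem_filter, Finset.mem_ssubsets, Finset.ssubset_singleton_iff] at hA
  rw [hA.1] at hA
  simp at hA

lemma cumulant_gaussMoment_zero (M : α → α → ℝ) (S : Finset α) (hS : 2 ≤ S.card) :
    cumulant (gaussMoment M 0) S = 0 := by
  have hone : ∀ B, gaussMoment M 0 B = 1 := fun B => by simp [gaussMoment]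
  induction S using Finset.strongInduction with
  | H S ih =>
    obtain ⟨r, hr⟩ : S.Nonempty := Finset.card_pos.1 (by omega)
    rw [cumulant_eq_sub _ (hone ∅) hr, Finset.sum_eq_single_of_mem {r}]
    · rw [cumulant_singleton _ (hone ∅), hone, hone, hone]
      norm_num
    · simp only [Finset.mem_filter, Finset.mem_ssubsets, Finset.mem_singleton, and_true]
      refine Finset.ssubset_iff_subset_ne.2 ⟨Finset.singleton_subset_iff.2 hr, ?_⟩
      rintro rfl
      simp at hS
    · intro A hA hne
      simp only [Finset.mem_filter, Finset.mem_ssubsets] at hA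
      have hcard : 2 ≤ A.card := by
        by_contra hlt
        have h₀ : 0 < A.card := Finset.card_pos.2 ⟨r, hA.2⟩
        obtain ⟨x, rfl⟩ := Finset.card_eq_one.1 (show A.card = 1 by omega)
        exact hne (by rw [Finset.mem_singleton.1 hA.2])
      rw [ih A hA.1 hcard, zero_mul]

end Flow

/-- The nonempty proper subsets of `S`. -/
def properParts {α : Type*} [DecidableEq α] (S : Finset α) : Finset (Finset α) :=
  S.ssubsets.erase ∅

lemma mem_properParts {α : Type*} [DecidableEq α] {S A : Finset α} :
    A ∈ properParts S ↔ A.Nonempty ∧ A ⊂ S := by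
  simp [properParts, Finset.nonempty_iff_ne_empty]

lemma sdiff_mem_properParts {α : Type*} [DecidableEq α] {S A : Finset α}
    (hA : A ∈ properParts S) : S \ A ∈ properParts S := by
  obtain ⟨hne, hss⟩ := mem_properParts.1 hA
  exact mem_properParts.2 ⟨Finset.sdiff_nonempty.2 hss.2, Finset.sdiff_ssubset hss.1 hne⟩

/-- The sum over the spanning trees of `S` of the products of the edge weights `w`, given by the
recursion that removes one edge of the tree. -/
def treeWeight {α : Type*} [DecidableEq α] (w : α → α → ℝ) (S : Finset α) : ℝ :=
  if S.card ≤ 1 then 1 else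
    (2 * ((S.card - 1 : ℕ) : ℝ))⁻¹ * ∑ A ∈ (properParts S).attach,
      pairSum w A.1 (S \ A.1) * treeWeight w A.1 * treeWeight w (S \ A.1)
termination_by S.card
decreasing_by
  · exact Finset.card_lt_card (mem_properParts.1 A.2).2
  · exact Finset.card_lt_card (mem_properParts.1 (sdiff_mem_properParts A.2)).2

section TreeWeight

variable {α : Type*} [DecidableEq α]

lemma treeWeight_of_card_le_one (w : α → α → ℝ) {S : Finset α} (hS : S.card ≤ 1) :
    treeWeight w S = 1 := by
  rw [treeWeight, if_pos hS]

lemma treeWeight_rec (w : α → α → ℝ) {S : Finset α} (hS : 2 ≤ S.card) :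
    2 * ((S.card - 1 : ℕ) : ℝ) * treeWeight w S = ∑ A ∈ properParts S,
      pairSum w A (S \ A) * treeWeight w A * treeWeight w (S \ A) := by
  rw [treeWeight, if_neg (by omega), Finset.sum_attach (properParts S) fun A =>
    pairSum w A (S \ A) * treeWeight w A * treeWeight w (S \ A), mul_inv_cancel_left₀]
  have : S.card - 1 ≠ 0 := by omega
  positivity

lemma treeWeight_nonneg {w : α → α → ℝ} (hw : ∀ i j, 0 ≤ w i j) (S : Finset α) :
    0 ≤ treeWeight w S := by
  induction S using Finset.strongInduction with
  | H S ih =>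
    by_cases hS : S.card ≤ 1
    · rw [treeWeight_of_card_le_one w hS]
      exact zero_le_one
    · have hpos : 0 < 2 * ((S.card - 1 : ℕ) : ℝ) := by
        have : 0 < S.card - 1 := by omega
        positivity
      refine nonneg_of_mul_nonneg_right ?_ hpos
      rw [treeWeight_rec w (by omega)]
      exact Finset.sum_nonneg fun A hA => mul_nonneg (mul_nonneg (pairSum_nonneg hw _ _)
        (ih A (mem_properParts.1 hA).2)) (ih _ (mem_properParts.1 (sdiff_mem_properParts hA)).2)

lemma treeWeight_congr {w w' : α → α → ℝ} (S : Finset α)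
    (h : ∀ i ∈ S, ∀ j ∈ S, w i j = w' i j) : treeWeight w S = treeWeight w' S := by
  induction S using Finset.strongInduction with
  | H S ih =>
    by_cases hS : S.card ≤ 1
    · rw [treeWeight_of_card_le_one w hS, treeWeight_of_card_le_one w' hS]
    · have hpos : 2 * ((S.card - 1 : ℕ) : ℝ) ≠ 0 := by
        have : S.card - 1 ≠ 0 := by omega
        positivity
      refine mul_left_cancel₀ hpos ?_
      rw [treeWeight_rec w (by omega), treeWeight_rec w' (by omega)]
      refine Finset.sum_congr rfl fun A hA => ?_
      have hsub : ∀ B ∈ properParts S, treeWeight w B = treeWeight w' B := fun B hB =>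
        ih B (mem_properParts.1 hB).2 fun i hi j hj =>
          h i ((mem_properParts.1 hB).2.1 hi) j ((mem_properParts.1 hB).2.1 hj)
      rw [hsub A hA, hsub _ (sdiff_mem_properParts hA)]
      congr 2
      exact Finset.sum_congr rfl fun i hi => Finset.sum_congr rfl fun j hj =>
        h i ((mem_properParts.1 hA).2.1 hi) j (Finset.sdiff_subset hj)

lemma sum_powerset_pairSum_eq (M : α → α → ℝ) (F : Finset α → ℝ) (S : Finset α) :
    ∑ A ∈ S.powerset, pairSum M A (S \ A) * F A * F (S \ A) =
      ∑ A ∈ properParts S, pairSum M A (S \ A) * F A * F (S \ A) := by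
  symm
  refine Finset.sum_subset (fun A hA => Finset.mem_powerset.2 (mem_properParts.1 hA).2.1) ?_
  intro A hA hA'
  rw [mem_properParts, not_and_or, Finset.not_nonempty_iff_eq_empty] at hA'
  rcases hA' with rfl | hA'
  · simp
  · have : A = S := by
      by_contra hne
      exact hA' (Finset.ssubset_iff_subset_ne.2 ⟨Finset.mem_powerset.1 hA, hne⟩)
    simp [this]

/-- The tree bound for Gaussian cumulants: by positivity of the covariance, the linear term of
the flow equation can only decrease the absolute value. -/
lemma abs_cumulant_le_treeWeight {M : α → α → ℝ} (hM : ∀ i j, M i j = M j i)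
    (hpos : ∀ S, 0 ≤ pairSum M S S) (S : Finset α) (hS : S.Nonempty) (t : ℝ) (ht : 0 ≤ t) :
    |cumulant (gaussMoment M t) S| ≤
      t ^ (S.card - 1) * treeWeight (fun i j => |M i j|) S := by
  induction S using Finset.strongInduction generalizing t with
  | H S ih =>
  have hcardpos : 0 < S.card := Finset.card_pos.2 hS
  by_cases hcard : S.card ≤ 1
  · rw [treeWeight_of_card_le_one _ hcard]
    obtain ⟨r, rfl⟩ := Finset.card_eq_one.1 (show S.card = 1 by omega)
    rw [cumulant_singleton _ (gaussMoment_empty M t), Finset.card_singleton, Nat.sub_self, pow_zero,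
      mul_one, gaussMoment, Real.abs_exp, Real.exp_le_one_iff]
    have := mul_nonneg ht (hpos {r})
    linarith
  obtain ⟨m, hm⟩ : ∃ m, S.card = m + 2 := ⟨S.card - 2, by omega⟩
  set w : α → α → ℝ := fun i j => |M i j| with hw
  set κ : ℝ → Finset α → ℝ := fun t => cumulant (gaussMoment M t) with hκ
  set q : ℝ := pairSum M S S / 2 with hq
  have hq0 : 0 ≤ q := by have := hpos S; positivity
  have hT : 0 ≤ treeWeight w S := treeWeight_nonneg (fun i j => abs_nonneg _) S
  have hrec := treeWeight_rec w (S := S) (by omega)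
  rw [hm] at hrec
  have hquad : ∀ s, 0 ≤ s →
      |(1 / 2) * ∑ A ∈ S.powerset, pairSum M A (S \ A) * κ s A * κ s (S \ A)| ≤
        ((m : ℝ) + 1) * s ^ m * treeWeight w S := by
    intro s hs
    rw [sum_powerset_pairSum_eq, abs_mul, abs_of_pos (by norm_num : (0 : ℝ) < 1 / 2)]
    have hterm : ∀ A ∈ properParts S, |pairSum M A (S \ A) * κ s A * κ s (S \ A)| ≤
        s ^ m * (pairSum w A (S \ A) * treeWeight w A * treeWeight w (S \ A)) := by
      intro A hA
      have hA' := sdiff_mem_properParts hA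
      obtain ⟨hne, hss⟩ := mem_properParts.1 hA
      obtain ⟨hne', hss'⟩ := mem_properParts.1 hA'
      have h₁ := ih A hss hne s hs
      have h₂ := ih (S \ A) hss' hne' s hs
      have hexp : s ^ m = s ^ (A.card - 1) * s ^ ((S \ A).card - 1) := by
        have := Finset.card_sdiff_add_card_eq_card hss.1
        have := Finset.card_pos.2 hne
        have := Finset.card_pos.2 hne'
        rw [← pow_add]
        congr 1
        omega
      rw [abs_mul, abs_mul]
      calc |pairSum M A (S \ A)| * |κ s A| * |κ s (S \ A)|
          ≤ pairSum w A (S \ A) * (s ^ (A.card - 1) * treeWeight w A) *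
              (s ^ ((S \ A).card - 1) * treeWeight w (S \ A)) := by
            have hp := pairSum_nonneg (M := w) (fun i j => abs_nonneg _) A (S \ A)
            have hTA := treeWeight_nonneg (w := w) (fun i j => abs_nonneg _) A
            have := abs_pairSum_le M A (S \ A)
            gcongr
        _ = _ := by rw [hexp]; ring
    calc _ ≤ 1 / 2 * ∑ A ∈ properParts S,
          s ^ m * (pairSum w A (S \ A) * treeWeight w A * treeWeight w (S \ A)) := by
          gcongr
          exact (Finset.abs_sum_le_sum_abs _ _).trans (Finset.sum_le_sum hterm)
      _ = _ := by
          rw [← Finset.mul_sum, ← hrec]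
          push_cast [show m + 2 - 1 = m + 1 from rfl]
          ring
  have hexp : ∀ s : ℝ, HasDerivAt (fun s => Real.exp (s * q)) (Real.exp (s * q) * (1 * q)) s :=
    fun s => ((hasDerivAt_id s).mul_const q).exp
  have hu : ∀ s : ℝ, HasDerivAt (fun s => Real.exp (s * q) * κ s S)
      (-(Real.exp (s * q) *
        ((1 / 2) * ∑ A ∈ S.powerset, pairSum M A (S \ A) * κ s A * κ s (S \ A)))) s := by
    intro s
    refine ((hexp s).mul (hasDerivAt_cumulant hM s S hS)).congr_deriv ?_
    simp only [flowRate, hq, hκ]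
    ring
  have hB : ∀ s : ℝ, HasDerivAt (fun s => Real.exp (s * q) * s ^ (m + 1) * treeWeight w S)
      ((Real.exp (s * q) * (1 * q) * s ^ (m + 1) +
        Real.exp (s * q) * (((m + 1 : ℕ) : ℝ) * s ^ m)) * treeWeight w S) s := fun s =>
    ((hexp s).mul (hasDerivAt_pow (m + 1) s)).mul_const _
  have hfence := image_norm_le_of_norm_deriv_right_le_deriv_boundary (a := 0) (b := t)
    (fun s _ => (hu s).continuousAt.continuousWithinAt) (fun s _ => (hu s).hasDerivWithinAt)
    (by
      have : κ 0 S = 0 := cumulant_gaussMoment_zero M S (by omega)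
      simp [this]) hB
    (by
      intro s hs
      rw [norm_neg, norm_mul, Real.norm_eq_abs, Real.norm_eq_abs, Real.abs_exp]
      have h := mul_le_mul_of_nonneg_left (hquad s hs.1) (Real.exp_pos (s * q)).le
      have h' : 0 ≤ Real.exp (s * q) * (1 * q) * s ^ (m + 1) * treeWeight w S := by
        have := hs.1
        positivity
      push_cast
      linarith) (Set.right_mem_Icc.2 ht)
  rw [norm_mul, Real.norm_eq_abs, Real.norm_eq_abs, Real.abs_exp, mul_assoc] at hfence
  rw [hm, show m + 2 - 1 = m + 1 from rfl]
  exact le_of_mul_le_mul_left hfence (Real.exp_pos _)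

end TreeWeight

/-- The functions that agree with `F₀` outside `U`. -/
def agreeOff {α J : Type*} [Fintype α] [DecidableEq α] [Fintype J]
    (U : Finset α) (F₀ : α → J) : Finset (α → J) :=
  Finset.univ.filter fun F => ∀ i, i ∉ U → F i = F₀ i

/-- The tree weight of `S` for the edge weights `w (F i) (F j)`. -/
def labelledTreeWeight {α J : Type*} [DecidableEq α] (w : J → J → ℝ) (F : α → J) (S : Finset α) : ℝ :=
  treeWeight (fun i j => w (F i) (F j)) S

lemma labelledTreeWeight_congr {α J : Type*} [DecidableEq α] (w : J → J → ℝ) {F F' : α → J} {S : Finset α}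
    (h : ∀ i ∈ S, F i = F' i) : labelledTreeWeight w F S = labelledTreeWeight w F' S :=
  treeWeight_congr S fun i hi j hj => by rw [h i hi, h j hj]

section SumTreeWeight

variable {α J : Type*} [Fintype α] [DecidableEq α] [Fintype J]

lemma mem_agreeOff {U : Finset α} {F₀ F : α → J} :
    F ∈ agreeOff U F₀ ↔ ∀ i, i ∉ U → F i = F₀ i := by
  simp [agreeOff]

lemma sum_agreeOff_union {U V : Finset α} (hUV : Disjoint U V) (F₀ : α → J)
    (G : (α → J) → ℝ) :
    ∑ F ∈ agreeOff (U ∪ V) F₀, G F = ∑ F' ∈ agreeOff U F₀, ∑ F ∈ agreeOff V F', G F := by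
  have hmap : ∀ F ∈ agreeOff (U ∪ V) F₀,
      (fun i => if i ∈ V then F₀ i else F i) ∈ agreeOff U F₀ := by
    intro F hF
    rw [mem_agreeOff] at hF ⊢
    intro i hi
    by_cases hV : i ∈ V
    · simp [hV]
    · simp [hV, hF i (by simp [hi, hV])]
  rw [← Finset.sum_fiberwise_of_maps_to hmap]
  refine Finset.sum_congr rfl fun F' hF' => Finset.sum_congr ?_ fun _ _ => rfl
  rw [mem_agreeOff] at hF'
  ext F
  rw [Finset.mem_filter, mem_agreeOff, mem_agreeOff]
  constructor
  · rintro ⟨-, rfl⟩ i hi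
    simp [hi]
  · intro h
    refine ⟨fun i hi => ?_, funext fun i => ?_⟩
    · rw [Finset.mem_union, not_or] at hi
      rw [h i hi.2, hF' i hi.1]
    · by_cases hV : i ∈ V
      · simp [hV, hF' i (Finset.disjoint_right.1 hUV hV)]
      · simp [hV, h i hV]

lemma sum_agreeOff_singleton (k : α) (F₀ : α → J) (G : J → ℝ) :
    ∑ F ∈ agreeOff {k} F₀, G (F k) = ∑ l, G l := by
  refine Finset.sum_bij' (fun F _ => F k) (fun l _ => Function.update F₀ k l) ?_ ?_ ?_ ?_ ?_
  · intro F _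
    exact Finset.mem_univ _
  · intro l _
    rw [mem_agreeOff]
    intro i hi
    rw [Finset.mem_singleton] at hi
    exact Function.update_of_ne hi _ _
  · intro F hF
    rw [mem_agreeOff] at hF
    funext i
    by_cases hi : i = k
    · subst hi
      simp
    · rw [Function.update_of_ne hi, hF i (by simpa using hi)]
  · intro l _
    simp
  · intro F _
    rfl

lemma sum_agreeOff_edge_le {w : J → J → ℝ} (hw : ∀ p q, 0 ≤ w p q) {κ zA zB : ℝ}
    (hκ : ∀ p, ∑ q, w p q ≤ κ) {A B : Finset α} (hAB : Disjoint A B) {r j k : α}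
    (hr : r ∈ A) (hj : j ∈ A) (hk : k ∈ B) (F₀ : α → J) (hzB : 0 ≤ zB)
    (hA : ∑ F ∈ agreeOff (A.erase r) F₀, labelledTreeWeight w F A ≤ zA)
    (hB : ∀ F₁, ∑ F ∈ agreeOff (B.erase k) F₁, labelledTreeWeight w F B ≤ zB) :
    ∑ F ∈ agreeOff ((A ∪ B).erase r) F₀,
      w (F j) (F k) * labelledTreeWeight w F A * labelledTreeWeight w F B ≤ κ * zA * zB := by
  have hκ0 : 0 ≤ κ := (Finset.sum_nonneg fun q _ => hw (F₀ j) q).trans (hκ (F₀ j))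
  have hrB : r ∉ B := Finset.disjoint_left.1 hAB hr
  have hunion : (A ∪ B).erase r = A.erase r ∪ ({k} ∪ B.erase k) := by
    rw [Finset.erase_union_distrib, Finset.erase_eq_of_notMem hrB, ← Finset.insert_eq,
      Finset.insert_erase hk]
  have hd₁ : Disjoint (A.erase r) ({k} ∪ B.erase k) := by
    rw [← Finset.insert_eq, Finset.insert_erase hk]
    exact hAB.mono_left (Finset.erase_subset _ _)
  have hd₂ : Disjoint ({k} : Finset α) (B.erase k) := by simp
  have hTA : ∀ F : α → J, 0 ≤ labelledTreeWeight w F A := fun F =>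
    treeWeight_nonneg (fun i j => hw _ _) A
  rw [hunion, sum_agreeOff_union hd₁]
  have hinner : ∀ F₁ : α → J, ∑ F ∈ agreeOff ({k} ∪ B.erase k) F₁,
      w (F j) (F k) * labelledTreeWeight w F A * labelledTreeWeight w F B ≤
        κ * zB * labelledTreeWeight w F₁ A := by
    intro F₁
    rw [sum_agreeOff_union hd₂]
    calc _ ≤ ∑ F₂ ∈ agreeOff {k} F₁, w (F₁ j) (F₂ k) * (labelledTreeWeight w F₁ A * zB) := by
          refine Finset.sum_le_sum fun F₂ hF₂ => ?_
          rw [mem_agreeOff] at hF₂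
          have heq : ∀ F ∈ agreeOff (B.erase k) F₂,
              w (F j) (F k) * labelledTreeWeight w F A * labelledTreeWeight w F B =
              w (F₁ j) (F₂ k) * labelledTreeWeight w F₁ A * labelledTreeWeight w F B := by
            intro F hF
            rw [mem_agreeOff] at hF
            have hFA : ∀ i ∈ A, F i = F₁ i := by
              intro i hi
              have hiB : i ∉ B := Finset.disjoint_left.1 hAB hi
              rw [hF i fun h => hiB (Finset.mem_of_mem_erase h), hF₂ i]
              rw [Finset.mem_singleton]
              rintro rfl
              exact hiB hk
            rw [hFA j hj, hF k (Finset.notMem_erase k B), labelledTreeWeight_congr w hFA]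
          rw [Finset.sum_congr rfl heq, ← Finset.mul_sum, mul_assoc]
          have := hB F₂
          have := hTA F₁
          have := hw (F₁ j) (F₂ k)
          gcongr
      _ = (∑ q, w (F₁ j) q) * (labelledTreeWeight w F₁ A * zB) := by
          rw [← Finset.sum_mul, sum_agreeOff_singleton k F₁ (fun q => w (F₁ j) q)]
      _ ≤ κ * (labelledTreeWeight w F₁ A * zB) :=
          mul_le_mul_of_nonneg_right (hκ _) (mul_nonneg (hTA F₁) hzB)
      _ = _ := by ring
  calc _ ≤ ∑ F₁ ∈ agreeOff (A.erase r) F₀, κ * zB * labelledTreeWeight w F₁ A :=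
        Finset.sum_le_sum fun F₁ _ => hinner F₁
    _ ≤ κ * zB * zA := by
        rw [← Finset.mul_sum]
        exact mul_le_mul_of_nonneg_left hA (mul_nonneg hκ0 hzB)
    _ = _ := by ring

lemma sum_agreeOff_pairSum_le {w : J → J → ℝ} (hw : ∀ p q, 0 ≤ w p q) {κ zA zB : ℝ}
    (hκ : ∀ p, ∑ q, w p q ≤ κ) {A B : Finset α} (hAB : Disjoint A B) {r : α}
    (hr : r ∈ A) (F₀ : α → J) (hzB : 0 ≤ zB)
    (hA : ∑ F ∈ agreeOff (A.erase r) F₀, labelledTreeWeight w F A ≤ zA)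
    (hB : ∀ k ∈ B, ∀ F₁, ∑ F ∈ agreeOff (B.erase k) F₁, labelledTreeWeight w F B ≤ zB) :
    ∑ F ∈ agreeOff ((A ∪ B).erase r) F₀, pairSum (fun i j => w (F i) (F j)) A B *
      labelledTreeWeight w F A * labelledTreeWeight w F B ≤
      (A.card : ℝ) * (B.card : ℝ) * (κ * zA * zB) := by
  simp only [pairSum, Finset.sum_mul]
  rw [Finset.sum_comm]
  rw [mul_assoc, ← nsmul_eq_mul, ← nsmul_eq_mul]
  refine Finset.sum_le_card_nsmul _ _ _ fun j hj => ?_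
  rw [Finset.sum_comm]
  exact Finset.sum_le_card_nsmul _ _ _ fun k hk =>
    sum_agreeOff_edge_le hw hκ hAB hr hj hk F₀ hzB hA (hB k hk)

/-- Summing the tree weights over all labels but one yields Cayley's number of trees. -/
lemma sum_labelledTreeWeight_le {w : J → J → ℝ} (hw : ∀ p q, 0 ≤ w p q)
    (hsymm : ∀ p q, w p q = w q p) {κ : ℝ} (hκ0 : 0 ≤ κ) (hκ : ∀ p, ∑ q, w p q ≤ κ)
    (S : Finset α) (r : α) (hr : r ∈ S) (F₀ : α → J) :
    ∑ F ∈ agreeOff (S.erase r) F₀, labelledTreeWeight w F S ≤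
      (S.card : ℝ) ^ (S.card - 2) * κ ^ (S.card - 1) := by
  induction S using Finset.strongInduction generalizing r F₀ with
  | H S ih =>
  have hcardpos : 0 < S.card := Finset.card_pos.2 ⟨r, hr⟩
  by_cases hcard : S.card ≤ 1
  · obtain ⟨x, rfl⟩ := Finset.card_eq_one.1 (show S.card = 1 by omega)
    obtain rfl := Finset.mem_singleton.1 hr
    have : agreeOff (({r} : Finset α).erase r) F₀ = {F₀} := by
      ext F
      simp [mem_agreeOff, funext_iff]
    rw [this, Finset.sum_singleton, labelledTreeWeight, treeWeight_of_card_le_one _ (by simp)]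
    simp
  have hS : 2 ≤ S.card := by omega
  have hpos : 0 < 2 * ((S.card - 1 : ℕ) : ℝ) := by
    have : 0 < S.card - 1 := by omega
    positivity
  refine le_of_mul_le_mul_left ?_ hpos
  set c : Finset α → ℝ := fun A => (A.card : ℝ) ^ (A.card - 2) with hc
  have hc0 : ∀ A, 0 ≤ c A := fun A => by positivity
  have hrooted : ∀ A ∈ properParts S, r ∈ A →
      ∑ F ∈ agreeOff (S.erase r) F₀, pairSum (fun i j => w (F i) (F j)) A (S \ A) *
        labelledTreeWeight w F A * labelledTreeWeight w F (S \ A) ≤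
      κ ^ (S.card - 1) * (((A.card : ℝ) * c A) * (((S \ A).card : ℝ) * c (S \ A))) := by
    intro A hA hrA
    obtain ⟨hne, hss⟩ := mem_properParts.1 hA
    obtain ⟨hne', hss'⟩ := mem_properParts.1 (sdiff_mem_properParts hA)
    have h := sum_agreeOff_pairSum_le hw hκ (A := A) (B := S \ A) Finset.disjoint_sdiff hrA F₀
      (mul_nonneg (hc0 (S \ A)) (pow_nonneg hκ0 ((S \ A).card - 1)))
      (ih A hss r hrA F₀) (fun k hk F₁ => ih (S \ A) hss' k hk F₁)
    rw [Finset.union_sdiff_of_subset hss.1] at h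
    refine h.trans_eq ?_
    have hexp : S.card - 1 = 1 + (A.card - 1) + ((S \ A).card - 1) := by
      have := Finset.card_sdiff_add_card_eq_card hss.1
      have := Finset.card_pos.2 hne
      have := Finset.card_pos.2 hne'
      omega
    rw [hexp, pow_add, pow_add, pow_one]
    ring
  have hall : ∀ A ∈ properParts S,
      ∑ F ∈ agreeOff (S.erase r) F₀, pairSum (fun i j => w (F i) (F j)) A (S \ A) *
        labelledTreeWeight w F A * labelledTreeWeight w F (S \ A) ≤
      κ ^ (S.card - 1) * (((A.card : ℝ) * c A) * (((S \ A).card : ℝ) * c (S \ A))) := by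
    intro A hA
    by_cases hrA : r ∈ A
    · exact hrooted A hA hrA
    · have h := hrooted (S \ A) (sdiff_mem_properParts hA) (Finset.mem_sdiff.2 ⟨hr, hrA⟩)
      rw [Finset.sdiff_sdiff_eq_self (mem_properParts.1 hA).2.1] at h
      calc _ = _ := Finset.sum_congr rfl fun F _ => by
            rw [pairSum_comm (fun i j => hsymm (F i) (F j)), mul_right_comm]
        _ ≤ _ := h
        _ = _ := by ring
  calc 2 * ((S.card - 1 : ℕ) : ℝ) * ∑ F ∈ agreeOff (S.erase r) F₀, labelledTreeWeight w F S
      = ∑ A ∈ properParts S, ∑ F ∈ agreeOff (S.erase r) F₀,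
          pairSum (fun i j => w (F i) (F j)) A (S \ A) *
            labelledTreeWeight w F A * labelledTreeWeight w F (S \ A) := by
        rw [Finset.sum_comm, Finset.mul_sum]
        exact Finset.sum_congr rfl fun F _ => treeWeight_rec _ hS
    _ ≤ ∑ A ∈ properParts S,
          κ ^ (S.card - 1) * (((A.card : ℝ) * c A) * (((S \ A).card : ℝ) * c (S \ A))) :=
        Finset.sum_le_sum hall
    _ ≤ ∑ A ∈ S.powerset,
          κ ^ (S.card - 1) * (((A.card : ℝ) * c A) * (((S \ A).card : ℝ) * c (S \ A))) := by
        refine Finset.sum_le_sum_of_subset_of_nonneg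
          (fun A hA => Finset.mem_powerset.2 (mem_properParts.1 hA).2.1) fun A _ _ => ?_
        have := hc0 A
        have := hc0 (S \ A)
        positivity
    _ = _ := by
        rw [← Finset.mul_sum, sum_powerset_tree_count S hS]
        ring

end SumTreeWeight

section GaussianExponentials

variable {Ω : Type*} [MeasurableSpace Ω] {P : Measure Ω} {ι : Type*} [Fintype ι]
  {A : ι → Ω → ℝ} {g : ι → ι → ℝ}

/-- The product over `B` of the exponentials has a Gaussian moment as its expectation. -/
lemma integral_prod_exp
    (hgauss : ∀ c : ι → ℝ,
      ∫ ω, Complex.exp (Complex.I * (∑ i, c i * A i ω : ℝ)) ∂P =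
        Complex.exp (-((∑ i, ∑ j, c i * c j * g i j : ℝ) : ℂ) / 2))
    {α : Type*} (c : α → ℝ) (f : α → ι) (B : Finset α) :
    ∫ ω, (∏ i ∈ B, Complex.exp (Complex.I * ((c i * A (f i) ω : ℝ)))) ∂P =
      (gaussMoment (fun i j => c i * c j * g (f i) (f j)) 1 B : ℂ) := by
  have hlin : ∀ h : ι → ℝ, ∑ x, (∑ i ∈ B, if f i = x then c i else 0) * h x =
      ∑ i ∈ B, c i * h (f i) := by
    intro h
    simp only [Finset.sum_mul]
    rw [Finset.sum_comm]
    exact Finset.sum_congr rfl fun i _ => by simp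
  have hintegrand : ∀ ω, ∏ i ∈ B, Complex.exp (Complex.I * ((c i * A (f i) ω : ℝ))) =
      Complex.exp (Complex.I *
        (∑ x, (∑ i ∈ B, if f i = x then c i else 0) * A x ω : ℝ)) := by
    intro ω
    rw [hlin fun x => A x ω, ← Complex.exp_sum, Complex.ofReal_sum, Finset.mul_sum]
  simp only [hintegrand]
  rw [hgauss]
  have hquad : ∑ x, ∑ y, (∑ i ∈ B, if f i = x then c i else 0) *
      (∑ i ∈ B, if f i = y then c i else 0) * g x y =
      pairSum (fun i j => c i * c j * g (f i) (f j)) B B := by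
    simp only [mul_assoc, ← Finset.mul_sum]
    rw [hlin fun x => ∑ y, (∑ i ∈ B, if f i = y then c i else 0) * g x y]
    simp only [hlin, Finset.mul_sum, pairSum]
  rw [hquad, gaussMoment, Complex.ofReal_exp]
  congr 1
  push_cast
  ring

/-- Positivity of the covariance, in terms of the pair interaction. -/
lemma pairSum_covariance_nonneg [IsProbabilityMeasure P]
    (hgauss : ∀ c : ι → ℝ,
      ∫ ω, Complex.exp (Complex.I * (∑ i, c i * A i ω : ℝ)) ∂P =
        Complex.exp (-((∑ i, ∑ j, c i * c j * g i j : ℝ) : ℂ) / 2))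
    {α : Type*} (c : α → ℝ) (f : α → ι) (B : Finset α) :
    0 ≤ pairSum (fun i j => c i * c j * g (f i) (f j)) B B := by
  have h := integral_prod_exp hgauss c f B
  have hle : ‖∫ ω, (∏ i ∈ B, Complex.exp (Complex.I * ((c i * A (f i) ω : ℝ)))) ∂P‖ ≤ 1 := by
    have := norm_integral_le_of_norm_le_const (μ := P) (C := 1)
      (f := fun ω => ∏ i ∈ B, Complex.exp (Complex.I * ((c i * A (f i) ω : ℝ))))
      (Filter.Eventually.of_forall fun ω => by
        rw [norm_prod]
        exact (Finset.prod_eq_one fun i _ => Complex.norm_exp_I_mul_ofReal _).le)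
    simpa using this
  rw [h, Complex.norm_real, gaussMoment, Real.norm_eq_abs, Real.abs_exp,
    Real.exp_le_one_iff] at hle
  linarith

lemma isSetPartition_iff {n : ℕ} (π : Finset (Finset (Fin n))) :
    IsSetPartition π ↔ IsPartitionOf Finset.univ π := by
  simp [IsSetPartition, IsPartitionOf]

lemma truncExp_eq_cumulant
    (hgauss : ∀ c : ι → ℝ,
      ∫ ω, Complex.exp (Complex.I * (∑ i, c i * A i ω : ℝ)) ∂P =
        Complex.exp (-((∑ i, ∑ j, c i * c j * g i j : ℝ) : ℂ) / 2))
    {n : ℕ} (c : Fin n → ℝ) (f : Fin n → ι) :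
    truncExp P (fun j ω => Complex.exp (Complex.I * ((c j * A (f j) ω : ℝ)))) =
      (cumulant (gaussMoment (fun i j => c i * c j * g (f i) (f j)) 1) Finset.univ : ℂ) := by
  have hparts : Finset.univ.filter (fun π : Finset (Finset (Fin n)) => IsSetPartition π) =
      partitions Finset.univ := by
    ext π
    simp [isSetPartition_iff, mem_partitions]
  rw [truncExp, hparts, cumulant]
  simp only [integral_prod_exp hgauss]
  push_cast
  rfl

/-- The tree bound for the truncated expectation of Gaussian exponentials. -/
lemma norm_truncExp_le_treeWeight [IsProbabilityMeasure P]
    (hgauss : ∀ c : ι → ℝ,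
      ∫ ω, Complex.exp (Complex.I * (∑ i, c i * A i ω : ℝ)) ∂P =
        Complex.exp (-((∑ i, ∑ j, c i * c j * g i j : ℝ) : ℂ) / 2))
    (hg : ∀ i j, g i j = g j i) {n : ℕ} (hn : 0 < n) (c : Fin n → ℝ) (f : Fin n → ι) :
    ‖truncExp P (fun j ω => Complex.exp (Complex.I * ((c j * A (f j) ω : ℝ))))‖ ≤
      treeWeight (fun i j => |c i * c j * g (f i) (f j)|) Finset.univ := by
  rw [truncExp_eq_cumulant hgauss, Complex.norm_real, Real.norm_eq_abs]
  have h := abs_cumulant_le_treeWeight (M := fun i j => c i * c j * g (f i) (f j))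
    (fun i j => by rw [hg, mul_comm (c i)]) (pairSum_covariance_nonneg hgauss c f)
    Finset.univ ⟨⟨0, hn⟩, Finset.mem_univ _⟩ 1 zero_le_one
  rwa [one_pow, one_mul] at h

end GaussianExponentials

theorem summed_tree_bound_boson_exponentials
    {Ω : Type*} [MeasurableSpace Ω] (P : Measure Ω) [IsProbabilityMeasure P]
    {Λ : Type*} [Fintype Λ] [Nonempty Λ]
    (A : (Fin 2 × Λ) → Ω → ℝ) (hAmeas : ∀ i, Measurable (A i))
    (g : (Fin 2 × Λ) → (Fin 2 × Λ) → ℝ)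
    -- the `A_i` are jointly centered Gaussian with covariance `g`
    (hgauss : ∀ c : (Fin 2 × Λ) → ℝ,
      ∫ ω, Complex.exp (Complex.I * (∑ i, c i * A i ω : ℝ)) ∂P =
        Complex.exp (-((∑ i, ∑ j, c i * c j * g i j : ℝ) : ℂ) / 2))
    (hcov : ∀ i j, g i j = ∫ ω, A i ω * A j ω ∂P)
    (e a : ℝ) (he : 0 < e) (ha : 0 < a)
    (K : ℝ)
    (hK : K = Finset.univ.sup' Finset.univ_nonempty
      (fun i : Fin 2 × Λ => ∑ j : Fin 2 × Λ, |g i j|))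
    (n : ℕ) (hn : 2 ≤ n) (i₁ : Fin 2 × Λ) (ε₁ : ℤˣ) :
    ∑ f ∈ Finset.univ.filter
        (fun f : Fin n → Fin 2 × Λ => f ⟨0, by omega⟩ = i₁),
      ∑ s ∈ Finset.univ.filter (fun s : Fin n → ℤˣ => s ⟨0, by omega⟩ = ε₁),
        ‖truncExp P (fun j ω =>
            Complex.exp (Complex.I *
              ((((s j : ℤ) : ℝ) * e * a * A (f j) ω : ℝ))))‖ ≤
      (n : ℝ) ^ (n - 2) * (2 * e ^ 2 * a ^ 2 * K) ^ (n - 1) := by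
  have hsymm : ∀ i j, g i j = g j i := fun i j => by
    rw [hcov, hcov]
    exact integral_congr_ae (Filter.Eventually.of_forall fun ω => mul_comm _ _)
  set w : (Fin 2 × Λ) × ℤˣ → (Fin 2 × Λ) × ℤˣ → ℝ :=
    fun p q => e ^ 2 * a ^ 2 * |g p.1 q.1| with hw
  have hrow : ∀ p, ∑ q, w p q ≤ 2 * e ^ 2 * a ^ 2 * K := by
    intro p
    have hle : ∑ j, |g p.1 j| ≤ K := by
      rw [hK]
      exact Finset.le_sup' (fun i : Fin 2 × Λ => ∑ j, |g i j|) (Finset.mem_univ p.1)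
    calc ∑ q, w p q = 2 * e ^ 2 * a ^ 2 * ∑ j, |g p.1 j| := by
          rw [Fintype.sum_prod_type]
          simp only [hw, Finset.sum_const, Finset.card_univ, Fintype.card_units_int,
            nsmul_eq_mul]
          rw [Finset.mul_sum]
          exact Finset.sum_congr rfl fun j _ => by push_cast; ring
      _ ≤ _ := by gcongr
  have hw0 : ∀ p q, 0 ≤ w p q := fun p q => by positivity
  have hκ0 : 0 ≤ 2 * e ^ 2 * a ^ 2 * K :=
    (Finset.sum_nonneg fun q _ => hw0 (i₁, ε₁) q).trans (hrow (i₁, ε₁))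
  have hterm : ∀ (f : Fin n → Fin 2 × Λ) (s : Fin n → ℤˣ),
      ‖truncExp P (fun j ω => Complex.exp (Complex.I *
        ((((s j : ℤ) : ℝ) * e * a * A (f j) ω : ℝ))))‖ ≤
        labelledTreeWeight w (fun j => (f j, s j)) Finset.univ := by
    intro f s
    refine (norm_truncExp_le_treeWeight hgauss hsymm (by omega)
      (fun j => ((s j : ℤ) : ℝ) * e * a) f).trans_eq (treeWeight_congr _ fun i _ j _ => ?_)
    have habs : ∀ u : ℤˣ, |((u : ℤ) : ℝ)| = 1 := fun u => by
      rcases Int.units_eq_one_or u with rfl | rfl <;> simp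
    simp only [hw, abs_mul, habs, abs_of_pos he, abs_of_pos ha]
    ring
  have hsum := sum_labelledTreeWeight_le hw0 (fun p q => by simp only [hw, hsymm p.1 q.1]) hκ0
    hrow Finset.univ (⟨0, by omega⟩ : Fin n) (Finset.mem_univ _) (fun _ => (i₁, ε₁))
  rw [Finset.card_univ, Fintype.card_fin] at hsum
  refine le_trans ?_ hsum
  refine (Finset.sum_le_sum fun f _ => Finset.sum_le_sum fun s _ => hterm f s).trans_eq ?_
  rw [← Finset.sum_product']
  refine Finset.sum_bij' (fun x _ j => (x.1 j, x.2 j))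
    (fun F _ => (fun j => (F j).1, fun j => (F j).2)) ?_ ?_ ?_ ?_ ?_
  · rintro ⟨f, s⟩ h
    simp only [Finset.mem_product, Finset.mem_filter, Finset.mem_univ, true_and] at h
    rw [mem_agreeOff]
    intro j hj
    obtain rfl : j = ⟨0, by omega⟩ := by simpa using hj
    exact Prod.ext h.1 h.2
  · intro F h
    rw [mem_agreeOff] at h
    simp [h ⟨0, by omega⟩ (Finset.notMem_erase _ _)]
  · intro x _
    rfl
  · intro F _
    rfl
  · intro x _
    rfl

end SommerfieldStmt12
end
end
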